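/- arXiv:1205.5001 — 3 statements merged into one kernel-verified Lean document; each statement's English description precedes it below -/
import Mathlib

section
/- Let p > 3 be prime and let E be an elliptic curve over F_p given in Weierstrass form y² + a₁xy + a₃y = x³ + a₂x² + a₄x + a₆ with discriminant Δ(E) ≠ 0 and j-invariant j(E) ≠ 0, 1728. Then, as an identity in ℚ_p, a_p(E) = φ(−6·c₆) · p · ₂G₂[1/4, 3/4; 1/3, 2/3 | 1 − 1728/j(E)]_p, where c₆ and j(E) are the standard Weierstrass quantities of E. -/
/-- The rational `q`, regarded as a `p`-adic integer (when `q ∈ ℚ ∩ ℤ_p`). -/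
noncomputable def toZp (p : ℕ) [Fact p.Prime] (q : ℚ) : ℤ_[p] :=
  if h : ‖(q : ℚ_[p])‖ ≤ 1 then ⟨(q : ℚ_[p]), h⟩ else 0

/-- McCarthy's function `ₙGₙ[a₁,…,aₙ; b₁,…,bₙ | t]_p`. -/
noncomputable def padicG (p : ℕ) [Fact p.Prime] (Γ : ℤ_[p] → ℤ_[p])
    (ω : ZMod p → ℤ_[p]) (n : ℕ) (A B : Fin n → ℚ) (t : ZMod p) : ℚ_[p] :=
  -1 / ((p : ℚ_[p]) - 1) * ∑ j ∈ Finset.range (p - 1),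
    (-1 : ℚ_[p]) ^ (j * n) * ((((ω t : ℚ_[p]))⁻¹) ^ j) *
    ∏ i : Fin n,
      ((Γ (toZp p (Int.fract (A i - (j : ℚ) / ((p : ℚ) - 1)))) : ℚ_[p]) /
          (Γ (toZp p (Int.fract (A i))) : ℚ_[p]) *
        ((Γ (toZp p (Int.fract (-(B i) + (j : ℚ) / ((p : ℚ) - 1)))) : ℚ_[p]) /
          (Γ (toZp p (Int.fract (-(B i)))) : ℚ_[p])) *
        (-(p : ℚ_[p])) ^
          (-Int.floor (Int.fract (A i) - (j : ℚ) / ((p : ℚ) - 1)) -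
            Int.floor (Int.fract (-(B i)) + (j : ℚ) / ((p : ℚ) - 1))))

/-- The Weierstrass quantity `c₄` of `y² + a₁xy + a₃y = x³ + a₂x² + a₄x + a₆`. -/
def wc4 (p : ℕ) (a1 a2 a3 a4 : ZMod p) : ZMod p :=
  (a1 ^ 2 + 4 * a2) ^ 2 - 24 * (2 * a4 + a1 * a3)

/-- The Weierstrass quantity `c₆`. -/
def wc6 (p : ℕ) (a1 a2 a3 a4 a6 : ZMod p) : ZMod p :=
  -(a1 ^ 2 + 4 * a2) ^ 3 + 36 * (a1 ^ 2 + 4 * a2) * (2 * a4 + a1 * a3) -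
    216 * (a3 ^ 2 + 4 * a6)

/-- The discriminant `Δ = (c₄³ - c₆²)/1728`. -/
noncomputable def wDelta (p : ℕ) [Fact p.Prime] (a1 a2 a3 a4 a6 : ZMod p) : ZMod p :=
  ((wc4 p a1 a2 a3 a4) ^ 3 - (wc6 p a1 a2 a3 a4 a6) ^ 2) / 1728

/-- The `j`-invariant `j = c₄³/Δ`. -/
noncomputable def wj (p : ℕ) [Fact p.Prime] (a1 a2 a3 a4 a6 : ZMod p) : ZMod p :=
  (wc4 p a1 a2 a3 a4) ^ 3 / wDelta p a1 a2 a3 a4 a6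

open PowerSeries in
/-- The exponential of a power series (meaningful when its constant coefficient vanishes). -/
noncomputable def expComp {K : Type*} [Field K] [CharZero K] (h : PowerSeries K) : PowerSeries K :=
  (PowerSeries.exp K).subst h

namespace expComp

open PowerSeries

variable {K : Type*} [Field K] [CharZero K]

theorem derivative_eq {h : K⟦X⟧} (hh : constantCoeff h = 0) :
    derivative K (expComp h) = derivative K h * expComp h := by
  rw [expComp, derivative_subst (HasSubst.of_constantCoeff_zero' hh), derivative_exp, mul_comm]

theorem coeff_eq_sum {h : K⟦X⟧} (hh : constantCoeff h = 0) (n : ℕ) :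
    coeff n (expComp h) = ∑ᶠ d : ℕ, ((d.factorial : K)⁻¹) * coeff n (h ^ d) := by
  rw [expComp, coeff_subst' (HasSubst.of_constantCoeff_zero' hh)]
  refine finsum_congr fun d => ?_
  simp [coeff_exp]

theorem constantCoeff_eq {h : K⟦X⟧} (hh : constantCoeff h = 0) :
    constantCoeff (expComp h) = 1 := by
  rw [← coeff_zero_eq_constantCoeff_apply, coeff_eq_sum hh, finsum_eq_single _ 0]
  · simp
  · intro d hd
    simp [hh, hd]

/-- Uniqueness for the first-order linear differential equation `d f = k f`. -/
theorem _root_.PowerSeries.eq_of_derivative_eq_mul {f g k : K⟦X⟧}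
    (h0 : constantCoeff f = constantCoeff g) (hf : derivative K f = k * f)
    (hg : derivative K g = k * g) : f = g := by
  ext n
  induction n using Nat.strong_induction_on with
  | _ n ih =>
    rcases n with _ | n
    · simpa using h0
    · have h1 := congrArg (coeff n) hf
      have h2 := congrArg (coeff n) hg
      rw [coeff_derivative, coeff_mul] at h1 h2
      have h3 : (coeff (n + 1) f) * ((n : K) + 1) = (coeff (n + 1) g) * ((n : K) + 1) := by
        rw [h1, h2]
        refine Finset.sum_congr rfl fun ij hij => ?_
        rw [ih ij.2 (by have := Finset.HasAntidiagonal.mem_antidiagonal.1 hij; omega)]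
      exact mul_right_cancel₀ (Nat.cast_add_one_ne_zero n) h3

theorem eq_of_derivative {h f : K⟦X⟧} (hh : constantCoeff h = 0) (hf0 : constantCoeff f = 1)
    (hf : derivative K f = derivative K h * f) : f = expComp h :=
  eq_of_derivative_eq_mul (by rw [hf0, constantCoeff_eq hh]) hf (derivative_eq hh)

theorem add {h₁ h₂ : K⟦X⟧} (hh₁ : constantCoeff h₁ = 0) (hh₂ : constantCoeff h₂ = 0) :
    expComp (h₁ + h₂) = expComp h₁ * expComp h₂ := by
  symm
  refine eq_of_derivative (by simp [hh₁, hh₂]) (by simp [constantCoeff_eq, hh₁, hh₂]) ?_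
  rw [Derivation.leibniz, derivative_eq hh₁, derivative_eq hh₂, map_add]
  simp only [smul_eq_mul]
  ring

theorem zero : expComp (0 : K⟦X⟧) = 1 :=
  (eq_of_derivative (by simp) (by simp) (by simp)).symm

theorem nsmul {h : K⟦X⟧} (hh : constantCoeff h = 0) (n : ℕ) :
    expComp (n • h) = expComp h ^ n := by
  induction n with
  | zero => simp [zero]
  | succ n ih => rw [succ_nsmul, add (by simp [hh]) hh, ih, pow_succ]

theorem C_mul_X (c : K) : expComp (C c * X) = rescale c (PowerSeries.exp K) := by
  rw [expComp, rescale_eq_subst, smul_eq_C_mul]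

theorem coeff_C_mul_X (c : K) (n : ℕ) :
    coeff n (expComp (C c * X)) = c ^ n / n.factorial := by
  simp [C_mul_X, coeff_rescale, coeff_exp, div_eq_mul_inv]

theorem C_mul_X_pow (c : K) {q : ℕ} (hq : q ≠ 0) :
    expComp (C c * X ^ q) = expand q hq (rescale c (PowerSeries.exp K)) := by
  have h1 : HasSubst (C c * X : K⟦X⟧) := HasSubst.of_constantCoeff_zero' (by simp)
  have h2 : HasSubst (X ^ q : K⟦X⟧) := HasSubst.X_pow hq
  rw [← C_mul_X, expand_apply, expComp, expComp, subst_comp_subst_apply h1 h2, subst_mul h2,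
    subst_X h2]
  congr 2
  exact (subst_C c).symm

theorem coeff_C_mul_X_pow (c : K) {q : ℕ} (hq : q ≠ 0) (n : ℕ) :
    coeff n (expComp (C c * X ^ q)) =
      if q ∣ n then c ^ (n / q) / (n / q).factorial else 0 := by
  simp [C_mul_X_pow c hq, coeff_expand, coeff_rescale, coeff_exp, div_eq_mul_inv]

end expComp

namespace PowerSeries

variable {K : Type*} [NormedField K] [IsUltrametricDist K]

theorem norm_coeff_mul_le {f g : K⟦X⟧} {C D ρ : ℝ} (hC : 0 ≤ C) (hD : 0 ≤ D) (hρ : 0 ≤ ρ)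
    (hf : ∀ n, ‖coeff n f‖ ≤ C * ρ ^ n) (hg : ∀ n, ‖coeff n g‖ ≤ D * ρ ^ n) (n : ℕ) :
    ‖coeff n (f * g)‖ ≤ C * D * ρ ^ n := by
  rw [coeff_mul]
  refine IsUltrametricDist.norm_sum_le_of_forall_le_of_nonneg (by positivity) fun ij hij => ?_
  rw [norm_mul, ← Finset.HasAntidiagonal.mem_antidiagonal.1 hij, pow_add]
  calc _ ≤ (C * ρ ^ ij.1) * (D * ρ ^ ij.2) :=
        mul_le_mul (hf _) (hg _) (norm_nonneg _) (by positivity)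
    _ = _ := by ring

theorem norm_coeff_pow_le {f : K⟦X⟧} {C ρ : ℝ} (hC : 0 ≤ C) (hρ : 0 ≤ ρ)
    (hf : ∀ n, ‖coeff n f‖ ≤ C * ρ ^ n) (d n : ℕ) :
    ‖coeff n (f ^ d)‖ ≤ C ^ d * ρ ^ n := by
  induction d generalizing n with
  | zero =>
    rw [pow_zero, coeff_one]
    split_ifs with h
    · simp [h]
    · simp only [norm_zero]; positivity
  | succ d ih =>
    rw [pow_succ, pow_succ]
    exact norm_coeff_mul_le (by positivity) hC hρ ih hf n

theorem norm_coeff_expComp_le [CharZero K] {h : K⟦X⟧} {s ρ : ℝ} (hh : constantCoeff h = 0)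
    (hs : 0 ≤ s) (hρ : 0 ≤ ρ) (hfac : ∀ d : ℕ, s ^ d ≤ ‖(d.factorial : K)‖)
    (hf : ∀ n, ‖coeff n h‖ ≤ s * ρ ^ n) (n : ℕ) :
    ‖coeff n (expComp h)‖ ≤ ρ ^ n := by
  rw [expComp.coeff_eq_sum hh, finsum_eq_sum_of_support_subset (s := Finset.range (n + 1))]
  · refine IsUltrametricDist.norm_sum_le_of_forall_le_of_nonneg (by positivity) fun d _ => ?_
    have h0 : 0 < ‖(d.factorial : K)‖ := by
      rw [norm_pos_iff]; exact_mod_cast d.factorial_ne_zero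
    rw [norm_mul, norm_inv, inv_mul_le_iff₀ h0]
    refine (norm_coeff_pow_le hs hρ hf d n).trans ?_
    gcongr
    exact hfac d
  · intro d hd
    by_contra hn
    apply hd
    simp only [Finset.coe_range, Set.mem_Iio, not_lt] at hn
    have : coeff n (h ^ d) = 0 := by
      apply coeff_of_lt_order
      refine lt_of_lt_of_le ?_ (le_order_pow_of_constantCoeff_eq_zero d hh)
      exact_mod_cast hn
    simp [this]

end PowerSeries

section radius

variable (p : ℕ) [hp : Fact p.Prime]

/-- The real number `p ^ (-1 / (2 (p - 1)))`. -/
noncomputable def dworkRadius : ℝ := ((p : ℝ)⁻¹) ^ (((2 * (p - 1) : ℕ) : ℝ)⁻¹)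

theorem dworkRadius_pos : 0 < dworkRadius p := by
  have := hp.out.pos
  unfold dworkRadius; positivity

theorem dworkRadius_pow : dworkRadius p ^ (2 * (p - 1)) = (p : ℝ)⁻¹ := by
  have := hp.out.two_le
  exact Real.rpow_inv_natCast_pow (by positivity) (by omega)

theorem dworkRadius_lt_one : dworkRadius p < 1 := by
  have := hp.out.two_le
  have h1 : (1 : ℝ) < p := by exact_mod_cast hp.out.one_lt
  refine Real.rpow_lt_one (by positivity) (inv_lt_one_of_one_lt₀ h1) ?_
  have : 0 < 2 * (p - 1) := by omega
  positivity

theorem padic_norm_natCast_eq {n : ℕ} (hn : n ≠ 0) :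
    ‖(n : ℚ_[p])‖ = dworkRadius p ^ (2 * (p - 1) * padicValNat p n) := by
  have h := Padic.norm_eq_zpow_neg_valuation (p := p) (x := (n : ℚ_[p])) (by exact_mod_cast hn)
  rw [h, Padic.valuation_natCast, pow_mul, dworkRadius_pow, zpow_neg, zpow_natCast, inv_pow]

theorem dworkRadius_pow_le_norm_factorial (d : ℕ) :
    (dworkRadius p ^ 2) ^ d ≤ ‖(d.factorial : ℚ_[p])‖ := by
  rw [padic_norm_natCast_eq p d.factorial_ne_zero, ← pow_mul]
  refine pow_le_pow_of_le_one (dworkRadius_pos p).le (dworkRadius_lt_one p).le ?_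
  rw [mul_assoc, sub_one_mul_padicValNat_factorial]
  omega

theorem two_mul_sub_one_mul_padicValNat_add_two_le (hp3 : 3 < p) {k : ℕ} (hk : 2 ≤ k)
    (hkp : k ≠ p) : 2 * (p - 1) * padicValNat p k + 2 ≤ k := by
  obtain ⟨q, rfl⟩ : ∃ q, p = q + 4 := ⟨p - 4, by omega⟩
  obtain ⟨m, hm⟩ := (pow_padicValNat_dvd : (q + 4) ^ padicValNat (q + 4) k ∣ k)
  rcases hv : padicValNat (q + 4) k with _ | _ | v
  · omega
  · rw [hv, zero_add, pow_one] at hm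
    have : m ≠ 1 := by rintro rfl; exact hkp (by rw [hm, mul_one])
    have : m ≠ 0 := by rintro rfl; omega
    have : 2 ≤ m := by omega
    simp
    nlinarith
  · have h0 : m ≠ 0 := by rintro rfl; omega
    have h1 : (q + 4) ^ (v + 2) ≤ k := by
      rw [hv] at hm
      rw [hm]
      exact Nat.le_mul_of_pos_right _ (Nat.pos_of_ne_zero h0)
    refine le_trans ?_ h1
    clear h1 hm hv hkp h0
    have : q ≠ 0 := by rintro rfl; exact absurd hp.out (by norm_num)
    obtain ⟨q, rfl⟩ : ∃ q', q = q' + 1 := ⟨q - 1, by omega⟩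
    rw [show q + 1 + 4 - 1 = q + 4 by omega]
    induction v with
    | zero => simp; nlinarith
    | succ v ih =>
      rw [pow_succ]
      refine le_trans ?_ (Nat.mul_le_mul_left _ (show 2 ≤ q + 1 + 4 by omega))
      nlinarith [ih, Nat.zero_le (q * v)]

end radius

section dwork

open PowerSeries

variable (p : ℕ) [hp : Fact p.Prime]

/-- The series `exp (X + X ^ p / p)`. -/
noncomputable def dworkSeries : PowerSeries ℚ_[p] := expComp (X + C ((p : ℚ_[p])⁻¹) * X ^ p)

/-- The coefficients of `exp (X + X ^ p / p)`. -/
noncomputable def dworkCoeff (n : ℕ) : ℚ_[p] := coeff n (dworkSeries p)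

theorem derivative_dworkSeries :
    derivative ℚ_[p] (dworkSeries p) = (1 + X ^ (p - 1)) * dworkSeries p := by
  have h0 : (p : ℚ_[p]) ≠ 0 := by exact_mod_cast hp.out.ne_zero
  rw [dworkSeries, expComp.derivative_eq (by simp [hp.out.ne_zero])]
  congr 1
  rw [map_add, derivative_X, Derivation.leibniz, derivative_C, derivative_pow, derivative_X]
  simp only [mul_zero, add_zero, mul_one, smul_eq_mul]
  rw [← mul_assoc, ← map_natCast (C (R := ℚ_[p])), ← map_mul, inv_mul_cancel₀ h0, map_one, one_mul]

theorem dworkCoeff_add (n : ℕ) :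
    ((n + p : ℕ) : ℚ_[p]) * dworkCoeff p (n + p) =
      dworkCoeff p (n + p - 1) + dworkCoeff p n := by
  have hp0 := hp.out.pos
  have h := congrArg (coeff (n + p - 1)) (derivative_dworkSeries p)
  rw [coeff_derivative, add_mul, one_mul, map_add, coeff_X_pow_mul', if_pos (by omega),
    show n + p - 1 + 1 = n + p by omega, show n + p - 1 - (p - 1) = n by omega] at h
  rw [dworkCoeff, dworkCoeff, dworkCoeff, ← h, mul_comm, ← Nat.cast_add_one,
    show n + p - 1 + 1 = n + p by omega]

theorem dworkSeries_mul_one_sub :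
    dworkSeries p * (1 - X) = expComp (PowerSeries.mk fun k : ℕ =>
      if k < 2 ∨ k = p then 0 else -(k : ℚ_[p])⁻¹) := by
  have hp2 := hp.out.two_le
  have hF0 : constantCoeff (dworkSeries p) = 1 :=
    expComp.constantCoeff_eq (by simp [hp.out.ne_zero])
  refine expComp.eq_of_derivative (by simp [← coeff_zero_eq_constantCoeff_apply])
    (by simp [hF0]) ?_
  have hd : derivative ℚ_[p] (PowerSeries.mk fun k : ℕ =>
      if k < 2 ∨ k = p then 0 else -(k : ℚ_[p])⁻¹) =
        1 + X ^ (p - 1) - PowerSeries.mk 1 := by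
    ext n
    rw [coeff_derivative, coeff_mk, map_sub, map_add, coeff_one, coeff_X_pow, coeff_mk,
      Pi.one_apply]
    rcases Nat.eq_zero_or_pos n with rfl | hn
    · have h0 : 0 ≠ p - 1 := by omega
      simp [h0]
    · rw [if_neg hn.ne']
      by_cases h : n + 1 = p
      · rw [if_pos (by omega), if_pos (by omega)]; simp
      · rw [if_neg (by omega), if_neg (by omega)]
        have : ((n : ℚ_[p]) + 1) ≠ 0 := Nat.cast_add_one_ne_zero n
        push_cast
        field_simp
        simp
  rw [hd, Derivation.leibniz, derivative_dworkSeries, map_sub, derivative_X, derivative_one]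
  simp only [smul_eq_mul]
  have h1 : (PowerSeries.mk 1 : ℚ_[p]⟦X⟧) * (1 - X) = 1 := mk_one_mul_one_sub_eq_one _
  linear_combination dworkSeries p * h1

theorem norm_dworkCoeff_le (hp3 : 3 < p) (n : ℕ) :
    ‖dworkCoeff p n‖ ≤ ((dworkRadius p)⁻¹) ^ n := by
  have hr0 := dworkRadius_pos p
  have hr1 := dworkRadius_lt_one p
  have hp2 := hp.out.two_le
  have hE := norm_coeff_expComp_le (h := PowerSeries.mk fun k : ℕ =>
      if k < 2 ∨ k = p then 0 else -(k : ℚ_[p])⁻¹) (s := dworkRadius p ^ 2)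
      (ρ := (dworkRadius p)⁻¹) (by simp [← coeff_zero_eq_constantCoeff_apply])
      (by positivity) (by positivity) (dworkRadius_pow_le_norm_factorial p) (by
        intro k
        rw [coeff_mk]
        split_ifs with h
        · simp only [norm_zero]; positivity
        · push Not at h
          have hk := two_mul_sub_one_mul_padicValNat_add_two_le p hp3 h.1 h.2
          rw [norm_neg, norm_inv, padic_norm_natCast_eq p (by omega), inv_pow,
            ← div_eq_mul_inv, le_div_iff₀ (by positivity), inv_mul_le_iff₀ (by positivity),
            ← pow_add]
          exact pow_le_pow_of_le_one hr0.le hr1.le hk)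
  have h1 : (PowerSeries.mk 1 : ℚ_[p]⟦X⟧) * (1 - X) = 1 := mk_one_mul_one_sub_eq_one _
  have h2 : dworkSeries p = expComp (PowerSeries.mk fun k : ℕ =>
      if k < 2 ∨ k = p then 0 else -(k : ℚ_[p])⁻¹) * PowerSeries.mk 1 := by
    rw [← dworkSeries_mul_one_sub, mul_assoc, mul_comm (1 - X), h1, mul_one]
  have h3 := norm_coeff_mul_le (C := 1) (D := 1) (ρ := (dworkRadius p)⁻¹) zero_le_one
    zero_le_one (by positivity) (by simpa using hE) (g := PowerSeries.mk 1) (by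
      intro k
      rw [coeff_mk, Pi.one_apply, norm_one, one_mul]
      exact one_le_pow₀ (one_le_inv_iff₀.2 ⟨hr0, hr1.le⟩)) n
  rw [dworkCoeff, h2]
  simpa using h3

theorem exp_eq_dworkSeries_mul :
    expComp (C (1 : ℚ_[p]) * X) = dworkSeries p * expComp (C (-(p : ℚ_[p])⁻¹) * X ^ p) := by
  rw [dworkSeries, ← expComp.add (by simp [hp.out.ne_zero]) (by simp [hp.out.ne_zero])]
  congr 1
  simp

theorem inv_factorial_eq_sum_dworkCoeff {a : ℕ} (ha : a < p) (n : ℕ) :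
    (((p * n + a).factorial : ℚ_[p]))⁻¹ = ∑ k ∈ Finset.range (n + 1),
      dworkCoeff p (p * k + a) *
        ((-(p : ℚ_[p])⁻¹) ^ (n - k) / ((n - k).factorial : ℚ_[p])) := by
  have hp0 := hp.out.pos
  have h := congrArg (coeff (p * n + a)) (exp_eq_dworkSeries_mul p)
  rw [expComp.coeff_C_mul_X, one_pow, one_div, coeff_mul] at h
  rw [h]
  symm
  refine Finset.sum_of_injOn (fun k => (p * k + a, p * (n - k))) ?_ ?_ ?_ ?_
  · intro k _ l _ hkl
    simp only [Prod.mk.injEq] at hkl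
    exact Nat.eq_of_mul_eq_mul_left hp0 (by omega)
  · intro k hk
    simp only [Finset.coe_range, Set.mem_Iio] at hk
    simp only [SetLike.mem_coe, Finset.HasAntidiagonal.mem_antidiagonal]
    rw [show n = k + (n - k) by omega]
    simp
    ring
  · rintro ⟨i, j⟩ hij hne
    rw [Finset.HasAntidiagonal.mem_antidiagonal] at hij
    simp only at hij ⊢
    rw [expComp.coeff_C_mul_X_pow _ hp0.ne', if_neg, mul_zero]
    rintro ⟨m, rfl⟩
    apply hne
    have hmn : m ≤ n := by
      by_contra hlt
      have : p * (n + 1) ≤ p * m := Nat.mul_le_mul_left _ (by omega)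
      rw [mul_add] at this
      omega
    refine ⟨n - m, by simp, ?_⟩
    simp only [Prod.mk.injEq]
    obtain ⟨q, rfl⟩ := Nat.exists_eq_add_of_le hmn
    constructor
    · rw [Nat.add_sub_cancel_left]
      rw [mul_add] at hij
      omega
    · congr 1; omega
  · intro k _
    rw [expComp.coeff_C_mul_X_pow _ hp0.ne', if_pos (dvd_mul_right _ _),
      Nat.mul_div_cancel_left _ hp0]
    rfl

theorem dworkCoeff_of_lt {n : ℕ} (hn : n < p) : dworkCoeff p n = ((n.factorial : ℚ_[p]))⁻¹ := by
  have h := inv_factorial_eq_sum_dworkCoeff p hn 0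
  simpa using h.symm

end dwork

section trace

variable (p : ℕ) [hp : Fact p.Prime]

theorem norm_p_pow_mul_dworkCoeff_le (hp3 : 3 < p) {a n m : ℕ} (hm : m ≤ p * n + a) :
    ‖(p : ℚ_[p]) ^ n * dworkCoeff p m‖ ≤
      ((dworkRadius p)⁻¹) ^ a * (dworkRadius p ^ (p - 2)) ^ n := by
  have hr0 := dworkRadius_pos p
  have hr1 := dworkRadius_lt_one p
  rw [norm_mul, norm_pow, Padic.norm_p, ← dworkRadius_pow, ← pow_mul]
  calc _ ≤ dworkRadius p ^ (2 * (p - 1) * n) * (dworkRadius p)⁻¹ ^ (p * n + a) := by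
        gcongr
        exact (norm_dworkCoeff_le p hp3 m).trans
          (pow_le_pow_right₀ (one_le_inv_iff₀.2 ⟨hr0, hr1.le⟩) hm)
    _ = _ := by
        rw [pow_add, ← pow_mul, show 2 * (p - 1) * n = (p - 2) * n + p * n by
          rw [← add_mul]; congr 1; omega, pow_add]
        have : dworkRadius p ^ (p * n) * (dworkRadius p)⁻¹ ^ (p * n) = 1 := by
          rw [← mul_pow, mul_inv_cancel₀ hr0.ne', one_pow]
        linear_combination ((dworkRadius p)⁻¹ ^ a * dworkRadius p ^ ((p - 2) * n)) * this

theorem summable_geometric_dworkRadius (hp3 : 3 < p) (C : ℝ) :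
    Summable fun n : ℕ => C * (dworkRadius p ^ (p - 2)) ^ n :=
  (summable_geometric_of_lt_one (pow_nonneg (dworkRadius_pos p).le _)
    (pow_lt_one₀ (dworkRadius_pos p).le (dworkRadius_lt_one p) (by omega))).mul_left C

/-- The trace of the twisted Dwork operator equals `(1 - p)⁻¹` times its value on the
one-dimensional cohomology. -/
theorem one_sub_mul_tsum_dworkCoeff (hp3 : 3 < p) (a : ℕ) (X : ℤ_[p])
    (hX : ((p : ℤ_[p]) - 1) * X = a) :
    (1 - (p : ℚ_[p])) * ∑' n : ℕ, (-(p : ℚ_[p])) ^ n * dworkCoeff p ((p - 1) * n + a) =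
      ∑' n : ℕ, (p : ℚ_[p]) ^ n * dworkCoeff p (p * n + a) *
        ∏ i ∈ Finset.range n, ((X : ℚ_[p]) + i) := by
  have hp0 := hp.out.pos
  have hX' : ((p : ℚ_[p]) - 1) * (X : ℚ_[p]) = a := by exact_mod_cast congrArg ((↑) : ℤ_[p] → ℚ_[p]) hX
  set v : ℕ → ℕ → ℚ_[p] := fun n m => ∏ i ∈ Finset.Ico m n, (-((X : ℚ_[p]) + i)) with hv
  set A : ℕ → ℕ → ℚ_[p] := fun n m => (-(p : ℚ_[p])) ^ n * dworkCoeff p (p * n + a - m) with hA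
  set B : ℕ → ℚ_[p] := fun n => ∑ m ∈ Finset.range n, v (n + 1) (m + 1) * A n m with hB
  have hvdiag : ∀ n, v n n = 1 := fun n => by simp [hv]
  have hvleft : ∀ n m, m < n → v n m = -((X : ℚ_[p]) + m) * v n (m + 1) := fun n m h =>
    Finset.prod_eq_prod_Ico_succ_bot h _
  have hvright : ∀ n m, m ≤ n → v (n + 1) m = -((X : ℚ_[p]) + n) * v n m := fun n m h => by
    simp only [hv]; rw [Finset.prod_Ico_succ_top h, mul_comm]
  have hvnorm : ∀ n m, ‖v n m‖ ≤ 1 := fun n m => by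
    simp only [hv, norm_prod]
    refine Finset.prod_le_one (fun _ _ => norm_nonneg _) fun i _ => ?_
    rw [norm_neg]
    exact_mod_cast PadicInt.norm_le_one (X + (i : ℤ_[p]))
  have hrel : ∀ n m, m ≤ n → A (n + 1) (m + 1) + ((X : ℚ_[p]) + m) * A (n + 1) m =
      p * (((X : ℚ_[p]) + (n + 1 : ℕ)) * A (n + 1) m + A n m) := by
    intro n m hmn
    have h1 : m ≤ p * n + a := by nlinarith
    obtain ⟨K, hK⟩ := Nat.exists_eq_add_of_le h1
    have hrec := dworkCoeff_add p K
    simp only [hA]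
    rw [show p * (n + 1) + a - (m + 1) = K + p - 1 by rw [mul_add]; omega,
      show p * (n + 1) + a - m = K + p by rw [mul_add]; omega,
      show p * n + a - m = K by omega]
    have hK' : (p : ℚ_[p]) * n + a = m + K := by exact_mod_cast hK
    push_cast at hrec ⊢
    rw [pow_succ]
    linear_combination (-(p : ℚ_[p])) ^ n * p * hrec +
      (-(p : ℚ_[p])) ^ n * p * dworkCoeff p (K + p) * (hX' + hK')
  have hstep : ∀ n, A (n + 1) (n + 1) - v (n + 1) 0 * A (n + 1) 0 =
      p * (B n - B (n + 1) + A n n) := by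
    intro n
    have h1 := Finset.sum_range_sub (fun m => v (n + 1) m * A (n + 1) m) (n + 1)
    simp only [hvdiag, one_mul] at h1
    have h2 : ∀ m ∈ Finset.range (n + 1),
        v (n + 1) (m + 1) * A (n + 1) (m + 1) - v (n + 1) m * A (n + 1) m =
        p * (v (n + 1) (m + 1) * A n m - v (n + 1 + 1) (m + 1) * A (n + 1) m) := by
      intro m hm
      have hm' : m ≤ n := by simpa [Nat.lt_succ_iff] using hm
      rw [hvright (n + 1) (m + 1) (by omega), hvleft (n + 1) m (by omega)]
      linear_combination v (n + 1) (m + 1) * hrel n m hm'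
    rw [← h1, Finset.sum_congr rfl h2, ← Finset.mul_sum, Finset.sum_sub_distrib,
      Finset.sum_range_succ (fun m => v (n + 1) (m + 1) * A n m), hvdiag, one_mul]
    ring
  have hAnorm : ∀ n m, ‖A n m‖ ≤
      ((dworkRadius p)⁻¹) ^ a * (dworkRadius p ^ (p - 2)) ^ n := by
    intro n m
    have := norm_p_pow_mul_dworkCoeff_le p hp3 (a := a) (n := n) (Nat.sub_le (p * n + a) m)
    simpa [hA] using this
  have hsum := summable_geometric_dworkRadius p hp3 (((dworkRadius p)⁻¹) ^ a)
  have hDs : Summable fun n => A n n := Summable.of_norm_bounded hsum fun n => hAnorm n n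
  have hLs : Summable fun n => v n 0 * A n 0 := by
    refine Summable.of_norm_bounded hsum fun n => ?_
    rw [norm_mul]
    exact (mul_le_of_le_one_left (norm_nonneg _) (hvnorm n 0)).trans (hAnorm n 0)
  have hBlim : Filter.Tendsto B Filter.atTop (nhds 0) := by
    refine squeeze_zero_norm (fun n => ?_) hsum.tendsto_atTop_zero
    have hr0 := dworkRadius_pos p
    refine IsUltrametricDist.norm_sum_le_of_forall_le_of_nonneg (by positivity) fun m _ => ?_
    rw [norm_mul]
    exact (mul_le_of_le_one_left (norm_nonneg _) (hvnorm _ _)).trans (hAnorm n m)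
  have hD1 := (summable_nat_add_iff 1).2 hDs
  have hL1 := (summable_nat_add_iff 1).2 hLs
  have hf := ((hD1.hasSum.sub hL1.hasSum).sub (hDs.hasSum.mul_left (p : ℚ_[p]))).tendsto_sum_nat
  have hf' : ∀ M, ∑ n ∈ Finset.range M,
      (A (n + 1) (n + 1) - v (n + 1) 0 * A (n + 1) 0 - p * A n n) = p * (B 0 - B M) := by
    intro M
    rw [← Finset.sum_range_sub', Finset.mul_sum]
    refine Finset.sum_congr rfl fun n _ => ?_
    rw [hstep]; ring
  simp only [hf'] at hf
  have hlim : Filter.Tendsto (fun M => (p : ℚ_[p]) * (B 0 - B M)) Filter.atTop (nhds 0) := by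
    have : B 0 = 0 := by simp [hB]
    rw [this]
    simpa using (hBlim.const_sub 0).const_mul (p : ℚ_[p])
  have hfin := tendsto_nhds_unique hf hlim
  have hD0 := hDs.tsum_eq_zero_add
  have hL0 := hLs.tsum_eq_zero_add
  rw [hvdiag, one_mul] at hL0
  have e1 : (∑' n : ℕ, (-(p : ℚ_[p])) ^ n * dworkCoeff p ((p - 1) * n + a)) = ∑' n, A n n := by
    refine tsum_congr fun n => ?_
    simp only [hA]
    congr 2
    rw [Nat.sub_mul, one_mul]
    have : n ≤ p * n := Nat.le_mul_of_pos_left _ hp0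
    omega
  have e2 : (∑' n : ℕ, (p : ℚ_[p]) ^ n * dworkCoeff p (p * n + a) *
        ∏ i ∈ Finset.range n, ((X : ℚ_[p]) + i)) = ∑' n, v n 0 * A n 0 := by
    refine tsum_congr fun n => ?_
    simp only [hA, hv, Nat.sub_zero]
    rw [Finset.prod_neg, ← Finset.range_eq_Ico, Finset.card_range, neg_pow (p : ℚ_[p]) n]
    have : ((-1 : ℚ_[p]) ^ n) * (-1) ^ n = 1 := by rw [← mul_pow]; simp
    linear_combination (-(p : ℚ_[p]) ^ n * dworkCoeff p (p * n + a) *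
      ∏ i ∈ Finset.range n, ((X : ℚ_[p]) + i)) * this
  rw [e1, e2]
  linear_combination hfin + hD0 - hL0

end trace

section moritaGamma

variable {p : ℕ} [hp : Fact p.Prime] {Γ : ℤ_[p] → ℤ_[p]}

/-- The defining properties of Morita's `p`-adic gamma function. -/
structure IsMoritaGamma (Γ : ℤ_[p] → ℤ_[p]) : Prop where
  continuous : Continuous Γ
  map_zero : Γ 0 = 1
  map_natCast : ∀ m : ℕ, 0 < m →
    Γ (m : ℤ_[p]) = (-1) ^ m * ∏ k ∈ (Finset.Ico 1 m).filter (fun k => ¬ p ∣ k), (k : ℤ_[p])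

theorem PadicInt.norm_natCast_eq_one_iff_not_dvd (m : ℕ) : ‖(m : ℤ_[p])‖ = 1 ↔ ¬ p ∣ m := by
  rw [PadicInt.norm_natCast_eq_one_iff, hp.out.coprime_iff_not_dvd]

theorem PadicInt.continuous_ite_norm_eq_one {f g : ℤ_[p] → ℤ_[p]} (hf : Continuous f)
    (hg : Continuous g) : Continuous fun x : ℤ_[p] => if ‖x‖ = 1 then f x else g x := by
  refine Continuous.if (fun a ha => ?_) hf hg
  have h : IsClopen {x : ℤ_[p] | ‖x‖ = 1} := by
    have := IsUltrametricDist.isClopen_sphere (0 : ℤ_[p]) (r := 1) one_ne_zero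
    simpa [Metric.sphere, dist_zero_right] using this
  rw [h.frontier_eq] at ha
  exact ha.elim

theorem PadicInt.ext_natCast {Y : Type*} [TopologicalSpace Y] [T2Space Y]
    {f g : ℤ_[p] → Y} (hf : Continuous f) (hg : Continuous g)
    (h : ∀ n : ℕ, f n = g n) : f = g :=
  PadicInt.denseRange_natCast.equalizer hf hg (funext h)

theorem PadicInt.ext_neg_natCast {Y : Type*} [TopologicalSpace Y] [T2Space Y]
    {f g : ℤ_[p] → Y} (hf : Continuous f) (hg : Continuous g)
    (h : ∀ n : ℕ, f (-n) = g (-n)) : f = g := by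
  have := PadicInt.ext_natCast (hf.comp continuous_neg) (hg.comp continuous_neg) h
  funext x
  simpa using congrFun this (-x)

namespace IsMoritaGamma

theorem map_add_one (h : IsMoritaGamma Γ) (x : ℤ_[p]) :
    Γ (x + 1) = (if ‖x‖ = 1 then -x else -1) * Γ x := by
  refine congrFun (PadicInt.ext_natCast (f := fun x => Γ (x + 1))
    (g := fun x => (if ‖x‖ = 1 then -x else -1) * Γ x)
    (h.continuous.comp (continuous_id.add continuous_const))
    ((PadicInt.continuous_ite_norm_eq_one continuous_neg continuous_const).mul h.continuous)
    fun m => ?_) x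
  simp only [PadicInt.norm_natCast_eq_one_iff_not_dvd]
  have h1 := h.map_natCast (m + 1) m.succ_pos
  push_cast at h1
  rw [h1]
  rcases m.eq_zero_or_pos with rfl | hm
  · simp [h.map_zero]
  · rw [h.map_natCast m hm, ← Finset.insert_Ico_right_eq_Ico_add_one hm, Finset.filter_insert]
    split_ifs with hd
    · ring
    · rw [Finset.prod_insert (by simp)]; ring

theorem norm_eq_one (h : IsMoritaGamma Γ) (x : ℤ_[p]) : ‖Γ x‖ = 1 := by
  refine congrFun (PadicInt.ext_natCast (f := fun x => ‖Γ x‖)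
    (g := fun _ => (1 : ℝ)) h.continuous.norm continuous_const fun m => ?_) x
  induction m with
  | zero => simp [h.map_zero]
  | succ m ih =>
    push_cast
    rw [h.map_add_one, norm_mul, ih, mul_one]
    split_ifs with h1
    · rw [norm_neg, h1]
    · simp

theorem ne_zero (h : IsMoritaGamma Γ) (x : ℤ_[p]) : Γ x ≠ 0 := by
  rw [← norm_ne_zero_iff, h.norm_eq_one]; exact one_ne_zero

theorem map_neg_natCast_mul_factorial (h : IsMoritaGamma Γ) (M : ℕ) :
    Γ (-M) * (M.factorial : ℤ_[p]) = (-(p : ℤ_[p])) ^ (M / p) * ((M / p).factorial : ℤ_[p]) := by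
  induction M with
  | zero => simp [h.map_zero]
  | succ M ih =>
    have h1 := h.map_add_one (-((M + 1 : ℕ) : ℤ_[p]))
    simp only [show (-((M + 1 : ℕ) : ℤ_[p])) + 1 = -M by push_cast; ring, norm_neg,
      PadicInt.norm_natCast_eq_one_iff_not_dvd, neg_neg] at h1
    rw [Nat.succ_div, Nat.factorial_succ]
    rw [h1] at ih
    split_ifs with hd
    · rw [if_neg (not_not.2 hd)] at ih
      have h2 : (M + 1) = p * (M / p + 1) := by
        have := Nat.succ_div (a := M) (b := p)
        rw [if_pos hd] at this
        rw [← this]; exact (Nat.mul_div_cancel' hd).symm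
      have h3 : ((M + 1 : ℕ) : ℤ_[p]) = p * ((M / p + 1 : ℕ) : ℤ_[p]) := by exact_mod_cast h2
      rw [Nat.factorial_succ, pow_succ, Nat.cast_mul, Nat.cast_mul]
      linear_combination (-((M + 1 : ℕ) : ℤ_[p])) * ih -
        (-(p : ℤ_[p])) ^ (M / p) * ((M / p).factorial : ℤ_[p]) * h3
    · rw [if_pos hd] at ih
      rw [Nat.cast_mul, add_zero]
      linear_combination ih

theorem map_p_mul_sub (h : IsMoritaGamma Γ) (hp3 : 3 < p) {a : ℕ} (ha : a < p) (X : ℤ_[p]) :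
    (Γ ((p : ℤ_[p]) * X - a) : ℚ_[p]) = ∑' k : ℕ, (p : ℚ_[p]) ^ k * dworkCoeff p (p * k + a) *
        ∏ i ∈ Finset.range k, ((X : ℚ_[p]) + i) := by
  refine congrFun (PadicInt.ext_neg_natCast (f := fun X : ℤ_[p] => (Γ ((p : ℤ_[p]) * X - (a : ℤ_[p])) : ℚ_[p]))
    (g := fun X => ∑' k : ℕ, (p : ℚ_[p]) ^ k * dworkCoeff p (p * k + a) *
        ∏ i ∈ Finset.range k, ((X : ℚ_[p]) + i)) ?_ ?_ fun n => ?_) X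
  · exact continuous_subtype_val.comp (h.continuous.comp (by fun_prop))
  · refine continuous_tsum (fun k => ?_)
      (summable_geometric_dworkRadius p hp3 (((dworkRadius p)⁻¹) ^ a)) fun k X => ?_
    · refine continuous_const.mul (continuous_finsetProd _ fun i _ => ?_)
      exact continuous_subtype_val.add continuous_const
    · rw [norm_mul, norm_prod]
      refine (mul_le_of_le_one_right (norm_nonneg _) ?_).trans
        (norm_p_pow_mul_dworkCoeff_le p hp3 le_rfl)
      refine Finset.prod_le_one (fun _ _ => norm_nonneg _) fun i _ => ?_
      exact_mod_cast PadicInt.norm_le_one (X + (i : ℤ_[p]))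
  · have h1 := h.map_neg_natCast_mul_factorial (p * n + a)
    rw [show (p * n + a) / p = n by
      rw [Nat.mul_add_div hp.out.pos, Nat.div_eq_of_lt ha, add_zero]] at h1
    have h2 : (Γ (-((p * n + a : ℕ) : ℤ_[p])) : ℚ_[p]) * ((p * n + a).factorial : ℚ_[p]) =
        (-(p : ℚ_[p])) ^ n * (n.factorial : ℚ_[p]) := by
      simpa using congrArg ((↑) : ℤ_[p] → ℚ_[p]) h1
    have h0 : ((p * n + a).factorial : ℚ_[p]) ≠ 0 := by exact_mod_cast Nat.factorial_ne_zero _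
    have hp0 : (p : ℚ_[p]) ≠ 0 := by exact_mod_cast hp.out.ne_zero
    rw [← eq_div_iff h0, div_eq_mul_inv, inv_factorial_eq_sum_dworkCoeff p ha] at h2
    have e : (p : ℤ_[p]) * (-n) - a = -((p * n + a : ℕ) : ℤ_[p]) := by push_cast; ring
    rw [e, h2, tsum_eq_sum (s := Finset.range (n + 1)), Finset.mul_sum]
    · refine Finset.sum_congr rfl fun k hk => ?_
      have hk : k ≤ n := by simpa [Nat.lt_succ_iff] using hk
      obtain ⟨d, rfl⟩ := Nat.exists_eq_add_of_le hk
      have h3 : ∏ i ∈ Finset.range k, (((-((k + d : ℕ) : ℤ_[p]) : ℤ_[p]) : ℚ_[p]) + i) =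
          (-1) ^ k * ((k + d).factorial : ℚ_[p]) / (d.factorial : ℚ_[p]) := by
        rw [eq_div_iff (by exact_mod_cast Nat.factorial_ne_zero _)]
        clear h1 h2 h0 hk e
        have : ∀ k d : ℕ, (∏ i ∈ Finset.range k, (-((k + d : ℕ) : ℚ_[p]) + i)) * (d.factorial : ℚ_[p]) =
          (-1) ^ k * ((k + d).factorial : ℚ_[p]) := by
          intro k
          induction k with
          | zero => simp
          | succ k ih =>
            intro d
            have := ih (d + 1)
            rw [Finset.prod_range_succ, show k + 1 + d = k + (d + 1) by ring, pow_succ,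
              show (-((k + (d + 1) : ℕ) : ℚ_[p]) + k) = -((d + 1 : ℕ) : ℚ_[p]) by push_cast; ring]
            rw [Nat.factorial_succ, Nat.cast_mul] at this
            linear_combination -this
        simpa using this k d
      rw [h3, show k + d - k = d by omega, pow_add, neg_pow (p : ℚ_[p]) k]
      have h4 : (-(p : ℚ_[p])) ^ d * (-(p : ℚ_[p])⁻¹) ^ d = 1 := by
        rw [← mul_pow]; simp [hp0]
      linear_combination (-1) ^ k * (p : ℚ_[p]) ^ k * ((k + d).factorial : ℚ_[p]) *
        dworkCoeff p (p * k + a) / (d.factorial : ℚ_[p]) * h4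
    · intro k hk
      have hk : n < k := by simpa using hk
      rw [Finset.prod_eq_zero (Finset.mem_range.2 hk) (by simp), mul_zero]

theorem one_sub_mul_tsum_dworkCoeff (h : IsMoritaGamma Γ) (hp3 : 3 < p) {a : ℕ} (ha : a < p)
    (X : ℤ_[p]) (hX : ((p : ℤ_[p]) - 1) * X = a) :
    (1 - (p : ℚ_[p])) * ∑' n : ℕ, (-(p : ℚ_[p])) ^ n * dworkCoeff p ((p - 1) * n + a) = Γ X := by
  rw [_root_.one_sub_mul_tsum_dworkCoeff p hp3 a X hX, ← h.map_p_mul_sub hp3 ha]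
  congr 2
  linear_combination hX

end IsMoritaGamma

end moritaGamma

section multiplication

variable {p : ℕ} [hp : Fact p.Prime] {Γ : ℤ_[p] → ℤ_[p]}

theorem PadicInt.tendsto_natCast_prime_pow :
    Filter.Tendsto (fun k : ℕ => (p : ℤ_[p]) ^ k) Filter.atTop (nhds 0) := by
  refine tendsto_pow_atTop_nhds_zero_of_norm_lt_one ?_
  rw [PadicInt.norm_p]
  exact inv_lt_one_of_one_lt₀ (by exact_mod_cast hp.out.one_lt)

theorem PadicInt.tendsto_pow_prime_pow {x t : ℤ_[p]} (ht : t ^ p = t)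
    (hx : (p : ℤ_[p]) ∣ x - t) :
    Filter.Tendsto (fun k : ℕ => x ^ p ^ k) Filter.atTop (nhds t) := by
  have hk : ∀ k, t ^ p ^ k = t := fun k => by
    induction k with
    | zero => simp
    | succ k ih => rw [pow_succ, pow_mul, ih, ht]
  have h0 : Filter.Tendsto (fun k : ℕ => x ^ p ^ k - t) Filter.atTop (nhds 0) := by
    refine squeeze_zero_norm (fun k => ?_)
      (((Filter.tendsto_add_atTop_iff_nat 1).2 PadicInt.tendsto_natCast_prime_pow).norm.trans
        (by simp) : Filter.Tendsto (fun k : ℕ => ‖(p : ℤ_[p]) ^ (k + 1)‖) Filter.atTop (nhds 0))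
    have h1 := dvd_sub_pow_of_dvd_sub hx k
    rw [hk] at h1
    obtain ⟨c, hc⟩ := h1
    rw [hc, norm_mul]
    exact mul_le_of_le_one_right (norm_nonneg _) (PadicInt.norm_le_one c)
  simpa using h0.add_const t

namespace IsMoritaGamma

theorem prod_map_neg_natCast (h : IsMoritaGamma Γ) {m : ℕ} {u : ℤ_[p]} (hu : (m : ℤ_[p]) * u = 1)
    (M : ℕ) :
    ∏ i ∈ Finset.range m, Γ (u * (-(M : ℤ_[p]) + i)) =
      (m : ℤ_[p]) ^ (M - M / p) * (∏ i ∈ Finset.range m, Γ (u * i)) * Γ (-M) := by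
  have hun : ‖u‖ = 1 := PadicInt.isUnit_iff.1 (IsUnit.of_mul_eq_one_right _ hu)
  set G : ℤ_[p] → ℤ_[p] := fun x => ∏ i ∈ Finset.range m, Γ (u * (x + i)) with hG
  have hstep : ∀ x, G (x + 1) = (if ‖x‖ = 1 then -(u * x) else -1) * G x := by
    intro x
    have h1 : G (x + 1) * Γ (u * x) = G x * Γ (u * x + 1) := by
      have h2 := Finset.prod_range_succ (fun i : ℕ => Γ (u * (x + i))) m
      rw [Finset.prod_range_succ'] at h2
      have e : u * (x + m) = u * x + 1 := by linear_combination hu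
      simp only [Nat.cast_zero, add_zero, e] at h2
      rw [← h2]
      simp only [hG]
      congr 1
      refine Finset.prod_congr rfl fun i _ => ?_
      congr 2
      push_cast; ring
    rw [h.map_add_one, norm_mul, hun, one_mul] at h1
    exact mul_right_cancel₀ (h.ne_zero (u * x)) (by linear_combination h1)
  have hG0 : ∏ i ∈ Finset.range m, Γ (u * i) = G 0 := by simp [hG]
  rw [hG0]
  change G (-(M : ℤ_[p])) = _
  induction M with
  | zero => simp [h.map_zero]
  | succ M ih =>
    have h1 := hstep (-((M + 1 : ℕ) : ℤ_[p]))
    have h2 := h.map_add_one (-((M + 1 : ℕ) : ℤ_[p]))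
    simp only [show (-((M + 1 : ℕ) : ℤ_[p])) + 1 = -M by push_cast; ring, norm_neg,
      PadicInt.norm_natCast_eq_one_iff_not_dvd] at h1 h2
    rw [h1, h2] at ih
    have hle := Nat.div_le_self M p
    rw [Nat.succ_div]
    split_ifs at ih ⊢ with hd
    · rw [show M + 1 - (M / p + 1) = M - M / p by omega]
      linear_combination -ih
    · rw [show M + 1 - (M / p + 0) = M - M / p + 1 by omega, pow_succ]
      have h0 : ((M + 1 : ℕ) : ℤ_[p]) ≠ 0 := by exact_mod_cast M.succ_ne_zero
      refine mul_left_cancel₀ h0 ?_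
      linear_combination m * ih - ((M + 1 : ℕ) : ℤ_[p]) * G (-((M + 1 : ℕ) : ℤ_[p])) * hu

theorem prod_map_mul_add (h : IsMoritaGamma Γ) {m : ℕ} {u : ℤ_[p]} (hu : (m : ℤ_[p]) * u = 1)
    {t : ℤ_[p]} (ht : t ^ p = t) (htm : (p : ℤ_[p]) ∣ m - t) {a : ℕ} (ha : a < p)
    {x : ℤ_[p]} (hx : ((p : ℤ_[p]) - 1) * x = a) :
    ∏ i ∈ Finset.range m, Γ (u * (x + i)) =
      t ^ a * (∏ i ∈ Finset.range m, Γ (u * i)) * Γ x := by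
  have hp0 := hp.out.pos
  have hp1 : (p : ℤ_[p]) - 1 ≠ 0 := by
    rw [sub_ne_zero]; exact_mod_cast hp.out.one_lt.ne'
  set S : ℕ → ℕ := fun k => ∑ i ∈ Finset.range k, p ^ i with hS
  have hSsucc : ∀ k, S (k + 1) = p * S k + 1 := fun k => by
    simp only [hS]; rw [Finset.sum_range_succ', Finset.mul_sum]
    simp [pow_succ, mul_comm]
  have hSsucc' : ∀ k, S (k + 1) = S k + p ^ k := fun k => Finset.sum_range_succ _ _
  have hMdiv : ∀ k, a * S (k + 1) - a * S (k + 1) / p = p ^ k * a := fun k => by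
    have : a * S (k + 1) / p = a * S k := by
      rw [hSsucc, show a * (p * S k + 1) = p * (a * S k) + a by ring, Nat.mul_add_div hp0,
        Nat.div_eq_of_lt ha, add_zero]
    rw [this, hSsucc', mul_add, Nat.add_sub_cancel_left, mul_comm]
  have hMval : ∀ k, -((a * S (k + 1) : ℕ) : ℤ_[p]) = x - x * (p : ℤ_[p]) ^ (k + 1) := fun k => by
    have h1 : ((p : ℤ_[p]) - 1) * ((S (k + 1) : ℕ) : ℤ_[p]) = (p : ℤ_[p]) ^ (k + 1) - 1 := by
      have := mul_geom_sum (p : ℤ_[p]) (k + 1)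
      simpa [hS] using this
    refine mul_left_cancel₀ hp1 ?_
    push_cast
    linear_combination (-(a : ℤ_[p])) * h1 + ((p : ℤ_[p]) ^ (k + 1) - 1) * hx
  have hlim : Filter.Tendsto (fun k : ℕ => x - x * (p : ℤ_[p]) ^ (k + 1)) Filter.atTop (nhds x) := by
    have := ((Filter.tendsto_add_atTop_iff_nat 1).2
      (PadicInt.tendsto_natCast_prime_pow (p := p))).const_mul x
    simpa using this.const_sub x
  have hleft : Continuous fun x => ∏ i ∈ Finset.range m, Γ (u * (x + i)) :=
    continuous_finsetProd _ fun i _ => h.continuous.comp (by fun_prop)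
  refine tendsto_nhds_unique ((hleft.tendsto x).comp hlim) ?_
  have hright := (((PadicInt.tendsto_pow_prime_pow ht htm).pow a).mul_const
    (∏ i ∈ Finset.range m, Γ (u * i))).mul ((h.continuous.tendsto x).comp hlim)
  refine hright.congr fun k => ?_
  simp only [Function.comp_apply]
  rw [← hMval, h.prod_map_neg_natCast hu, hMdiv, pow_mul]

end IsMoritaGamma

end multiplication

section eval

open PowerSeries

variable {k K : Type*} [NormedField k] [NormedField K] [NormedAlgebra k K]

/-- The value at `z` of a power series with coefficients in `k`. -/
noncomputable def PowerSeries.tsumEval (z : K) (f : k⟦X⟧) : K :=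
  ∑' n : ℕ, algebraMap k K (coeff n f) * z ^ n

/-- Absolute convergence of a power series at `z`. -/
def PowerSeries.SummableAt (z : K) (f : k⟦X⟧) : Prop :=
  Summable fun n : ℕ => ‖algebraMap k K (coeff n f) * z ^ n‖

namespace PowerSeries.SummableAt

variable {z : K} {f g : k⟦X⟧}

theorem sum_antidiagonal_eq (z : K) (f g : k⟦X⟧) (n : ℕ) :
    ∑ ij ∈ Finset.HasAntidiagonal.antidiagonal n,
      (algebraMap k K (coeff ij.1 f) * z ^ ij.1) * (algebraMap k K (coeff ij.2 g) * z ^ ij.2) =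
      algebraMap k K (coeff n (f * g)) * z ^ n := by
  rw [coeff_mul, map_sum, Finset.sum_mul]
  refine Finset.sum_congr rfl fun ij hij => ?_
  rw [← Finset.HasAntidiagonal.mem_antidiagonal.1 hij, pow_add, map_mul]
  ring

theorem mul (hf : f.SummableAt z) (hg : g.SummableAt z) : (f * g).SummableAt z := by
  have := summable_norm_sum_mul_antidiagonal_of_summable_norm hf hg
  simp only [sum_antidiagonal_eq] at this
  exact this

theorem tsumEval_mul [CompleteSpace K] (hf : f.SummableAt z) (hg : g.SummableAt z) :
    (f * g).tsumEval z = f.tsumEval z * g.tsumEval z := by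
  have := tsum_mul_tsum_eq_tsum_sum_antidiagonal_of_summable_norm hf hg
  simp only [sum_antidiagonal_eq] at this
  exact this.symm

theorem tsumEval_one (z : K) : (1 : k⟦X⟧).tsumEval z = 1 := by
  rw [tsumEval, tsum_eq_single 0]
  · simp
  · intro n hn; simp [coeff_one, hn]

theorem one (z : K) : (1 : k⟦X⟧).SummableAt z := by
  refine summable_of_ne_finset_zero (s := {0}) fun n hn => ?_
  simp only [Finset.mem_singleton] at hn
  simp [coeff_one, hn]

theorem pow (hf : f.SummableAt z) (n : ℕ) : (f ^ n).SummableAt z := by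
  induction n with
  | zero => simpa using one z
  | succ n ih => rw [pow_succ]; exact ih.mul hf

theorem tsumEval_pow [CompleteSpace K] (hf : f.SummableAt z) (n : ℕ) :
    (f ^ n).tsumEval z = f.tsumEval z ^ n := by
  induction n with
  | zero => simpa using tsumEval_one z
  | succ n ih => rw [pow_succ, (hf.pow n).tsumEval_mul hf, ih, pow_succ]

theorem of_norm_coeff_le {C ρ : ℝ} (hρ : 0 ≤ ρ) (hz : ρ * ‖z‖ < 1)
    (hf : ∀ n, ‖coeff n f‖ ≤ C * ρ ^ n) : f.SummableAt z := by
  refine Summable.of_nonneg_of_le (fun _ => norm_nonneg _) (fun n => ?_)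
    ((summable_geometric_of_lt_one (by positivity) hz).mul_left C)
  rw [norm_mul, norm_algebraMap', norm_pow, mul_pow, ← mul_assoc]
  exact mul_le_mul_of_nonneg_right (hf n) (by positivity)

end PowerSeries.SummableAt

end eval

section rootsOfUnity

variable {K : Type*} [NormedField K] [IsUltrametricDist K]

theorem eq_one_of_pow_prime_eq_one {p : ℕ} (hp : p.Prime) {z : K} (hz : z ^ p = 1)
    (h : ‖z - 1‖ ^ (p - 1) < ‖(p : K)‖) : z = 1 := by
  by_contra hne
  obtain ⟨q, rfl⟩ : ∃ q, p = q + 1 := ⟨p - 1, by have := hp.pos; omega⟩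
  have hnorm : ‖z‖ = 1 := by
    have := congrArg norm hz
    rw [norm_pow, norm_one] at this
    exact (pow_eq_one_iff_of_nonneg (norm_nonneg _) hp.ne_zero).1 this
  have : Fact (q + 1).Prime := ⟨hp⟩
  have hprim : IsPrimitiveRoot z (q + 1) := by
    rw [← orderOf_eq_prime hz hne]; exact IsPrimitiveRoot.orderOf z
  have hprod := congrArg norm hprim.prod_one_sub_pow_eq_order
  rw [norm_prod] at hprod
  have hle : ∏ i ∈ Finset.range q, ‖1 - z ^ (i + 1)‖ ≤ ∏ i ∈ Finset.range q, ‖z - 1‖ := by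
    refine Finset.prod_le_prod (fun _ _ => norm_nonneg _) fun i _ => ?_
    rw [norm_sub_rev, ← geom_sum_mul, norm_mul]
    refine mul_le_of_le_one_left (norm_nonneg _) ?_
    refine IsUltrametricDist.norm_sum_le_of_forall_le_of_nonneg zero_le_one fun j _ => ?_
    rw [norm_pow, hnorm, one_pow]
  rw [hprod, Finset.prod_const, Finset.card_range] at hle
  rw [Nat.add_sub_cancel] at h
  push_cast at h
  exact absurd hle (not_le.2 h)

end rootsOfUnity

section dworkEval

open PowerSeries

variable {p : ℕ} [hp : Fact p.Prime] {K : Type*} [NormedField K] [NormedAlgebra ℚ_[p] K]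

theorem dworkSeries_summableAt (hp3 : 3 < p) {z : K} (hz : ‖z‖ ≤ dworkRadius p ^ 2) :
    (dworkSeries p).SummableAt z := by
  have hr0 := dworkRadius_pos p
  refine SummableAt.of_norm_coeff_le (C := 1) (ρ := (dworkRadius p)⁻¹) (by positivity) ?_
    fun n => by simpa [dworkCoeff] using norm_dworkCoeff_le p hp3 n
  calc _ ≤ (dworkRadius p)⁻¹ * dworkRadius p ^ 2 := by gcongr
    _ = dworkRadius p := by field_simp
    _ < 1 := dworkRadius_lt_one p

theorem expComp_C_mul_X_summableAt {z : K} (hz : ‖z‖ < 1) {c : ℚ_[p]}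
    (hc : ‖c‖ ≤ (p : ℝ)⁻¹) : (expComp (C c * X : ℚ_[p]⟦X⟧)).SummableAt z := by
  refine SummableAt.of_norm_coeff_le (C := 1) (ρ := 1) zero_le_one (by simpa using hz) fun n => ?_
  rw [expComp.coeff_C_mul_X, norm_div, norm_pow, one_pow, one_mul]
  have hr0 := dworkRadius_pos p
  refine div_le_one_of_le₀ (le_trans ?_ (dworkRadius_pow_le_norm_factorial p n)) (norm_nonneg _)
  refine pow_le_pow_left₀ (norm_nonneg _) (hc.trans ?_) n
  rw [← dworkRadius_pow]
  have := hp.out.two_le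
  exact pow_le_pow_of_le_one hr0.le (dworkRadius_lt_one p).le (by omega)

theorem tsumEval_dworkSeries_pow [CompleteSpace K] (hp3 : 3 < p) {z : K}
    (hz : ‖z‖ ≤ dworkRadius p ^ 2)
    (hzp : z ^ p = algebraMap ℚ_[p] K (-p) * z) : (dworkSeries p).tsumEval z ^ p = 1 := by
  have hp0 := hp.out.ne_zero
  have hpq : (p : ℚ_[p]) ≠ 0 := by exact_mod_cast hp0
  have hr0 := dworkRadius_pos p
  have hz1 : ‖z‖ < 1 := hz.trans_lt (pow_lt_one₀ hr0.le (dworkRadius_lt_one p) two_ne_zero)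
  have hF := dworkSeries_summableAt hp3 hz
  have hneg := expComp_C_mul_X_summableAt (p := p) hz1 (c := -p) (by simp)
  have hpos := expComp_C_mul_X_summableAt (p := p) hz1 (c := p) (by simp)
  have h1 : expComp (C (p : ℚ_[p]) * X) * expComp (C (-(p : ℚ_[p])) * X) = 1 := by
    rw [← expComp.add (by simp) (by simp), ← expComp.zero]
    congr 1; simp
  have h2 : expComp (C (1 : ℚ_[p]) * X ^ p) =
      dworkSeries p ^ p * expComp (C (-(p : ℚ_[p])) * X) := by
    rw [dworkSeries, ← expComp.nsmul (by simp [hp0]), ← expComp.add (by simp [hp0]) (by simp)]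
    congr 1
    have : C (p : ℚ_[p]) * C ((p : ℚ_[p])⁻¹) = 1 := by rw [← map_mul, mul_inv_cancel₀ hpq, map_one]
    rw [nsmul_eq_mul, map_neg, map_one, mul_add, ← map_natCast (C (R := ℚ_[p])), ← mul_assoc, this]
    ring
  have h3 : (expComp (C (1 : ℚ_[p]) * X ^ p)).tsumEval z =
      (expComp (C (-(p : ℚ_[p])) * X)).tsumEval z := by
    simp only [tsumEval]
    rw [← (mul_right_injective₀ hp0).tsum_eq]
    · refine tsum_congr fun n => ?_
      rw [expComp.coeff_C_mul_X_pow _ hp0, if_pos (dvd_mul_right _ _),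
        Nat.mul_div_cancel_left _ hp.out.pos, expComp.coeff_C_mul_X, pow_mul, hzp, mul_pow,
        ← map_pow, ← mul_assoc, ← map_mul]
      congr 2
      simp; ring
    · intro n hn
      by_contra hd
      refine hn ?_
      beta_reduce
      rw [expComp.coeff_C_mul_X_pow _ hp0, if_neg, map_zero, zero_mul]
      rintro ⟨m, rfl⟩
      exact hd ⟨m, rfl⟩
  have h1' := congrArg (tsumEval z) h1
  rw [hpos.tsumEval_mul hneg, SummableAt.tsumEval_one] at h1'
  have h2' := congrArg (tsumEval z) h2
  rw [(hF.pow p).tsumEval_mul hneg, hF.tsumEval_pow, h3] at h2'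
  exact mul_right_cancel₀ (right_ne_zero_of_mul_eq_one h1') (by rw [one_mul]; exact h2'.symm)

theorem norm_tsumEval_dworkSeries_sub_le [CompleteSpace K] [IsUltrametricDist K] (hp3 : 3 < p)
    {z : K} (hz : ‖z‖ ≤ dworkRadius p ^ 2) :
    ‖(dworkSeries p).tsumEval z - 1 - z‖ ≤ dworkRadius p ^ 3 := by
  have hr0 := dworkRadius_pos p
  have hr1 := (dworkRadius_lt_one p).le
  have hF : Summable fun n : ℕ => algebraMap ℚ_[p] K (coeff n (dworkSeries p)) * z ^ n :=
    (dworkSeries_summableAt hp3 hz).of_norm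
  have hc : ∀ n, n < p → coeff n (dworkSeries p) = ((n.factorial : ℚ_[p]))⁻¹ :=
    fun n hn => dworkCoeff_of_lt p hn
  have h := hF.sum_add_tsum_nat_add 2
  rw [Finset.sum_range_succ, Finset.sum_range_one, hc 0 (by omega), hc 1 (by omega)] at h
  have h' : (dworkSeries p).tsumEval z - 1 - z =
      ∑' n : ℕ, algebraMap ℚ_[p] K (coeff (n + 2) (dworkSeries p)) * z ^ (n + 2) := by
    rw [tsumEval, ← h]; simp; ring
  rw [h']
  refine IsUltrametricDist.norm_tsum_le_of_forall_le_of_nonneg (by positivity) fun n => ?_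
  rw [norm_mul, norm_algebraMap', norm_pow]
  rcases n.eq_zero_or_pos with rfl | hn
  · rw [hc (0 + 2) (by omega)]
    have h2 : ‖((Nat.factorial (0 + 2) : ℕ) : ℚ_[p])‖ = 1 := by
      rw [Padic.norm_natCast_eq_one_iff, hp.out.coprime_iff_not_dvd]
      intro hd
      have := Nat.le_of_dvd (by norm_num) hd
      norm_num at this; omega
    rw [norm_inv, h2, inv_one, one_mul]
    calc ‖z‖ ^ (0 + 2) ≤ (dworkRadius p ^ 2) ^ (0 + 2) := by gcongr
      _ = dworkRadius p ^ 4 := by ring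
      _ ≤ _ := pow_le_pow_of_le_one hr0.le hr1 (by norm_num)
  · calc _ ≤ (dworkRadius p)⁻¹ ^ (n + 2) * (dworkRadius p ^ 2) ^ (n + 2) := by
          gcongr; exact norm_dworkCoeff_le p hp3 _
      _ = dworkRadius p ^ (n + 2) := by
          rw [← mul_pow]; congr 1; field_simp
      _ ≤ _ := pow_le_pow_of_le_one hr0.le hr1 (by omega)

end dworkEval

section teichmuller

variable {p : ℕ} [hp : Fact p.Prime] {ω : ZMod p → ℤ_[p]}

/-- The defining properties of the Teichmüller character. -/
structure IsTeichmuller (ω : ZMod p → ℤ_[p]) : Prop where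
  map_zero : ω 0 = 0
  map_mul : ∀ x y : ZMod p, ω (x * y) = ω x * ω y
  isUnit : ∀ x : ZMod p, x ≠ 0 → IsUnit (ω x)
  dvd_sub_val : ∀ x : ZMod p, (p : ℤ_[p]) ∣ (ω x - (x.val : ℤ_[p]))

theorem PadicInt.toZMod_eq_zero_iff_dvd (x : ℤ_[p]) :
    PadicInt.toZMod x = 0 ↔ (p : ℤ_[p]) ∣ x := by
  rw [← RingHom.mem_ker, PadicInt.ker_toZMod, PadicInt.maximalIdeal_eq_span_p,
    Ideal.mem_span_singleton]

namespace IsTeichmuller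

theorem map_one (h : IsTeichmuller ω) : ω 1 = 1 := by
  have h1 := h.map_mul 1 1
  rw [mul_one] at h1
  exact ((h.isUnit 1 one_ne_zero).mul_left_cancel (by rw [mul_one]; exact h1)).symm

theorem toZMod_apply (h : IsTeichmuller ω) (x : ZMod p) : PadicInt.toZMod (ω x) = x := by
  have h1 := (PadicInt.toZMod_eq_zero_iff_dvd _).2 (h.dvd_sub_val x)
  rw [map_sub, sub_eq_zero] at h1
  rw [h1, map_natCast, ZMod.natCast_zmod_val]

theorem injective (h : IsTeichmuller ω) : Function.Injective ω :=
  Function.LeftInverse.injective h.toZMod_apply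

theorem map_pow (h : IsTeichmuller ω) (x : ZMod p) (n : ℕ) : ω (x ^ n) = ω x ^ n := by
  induction n with
  | zero => simp [h.map_one]
  | succ n ih => rw [pow_succ, h.map_mul, ih, pow_succ]

theorem pow_prime (h : IsTeichmuller ω) (x : ZMod p) : ω x ^ p = ω x := by
  rw [← h.map_pow, ZMod.pow_card]

theorem dvd_natCast_sub (h : IsTeichmuller ω) (m : ℕ) : (p : ℤ_[p]) ∣ m - ω m := by
  rw [← PadicInt.toZMod_eq_zero_iff_dvd, map_sub, h.toZMod_apply, map_natCast, sub_self]

theorem dvd_add_sub (h : IsTeichmuller ω) (x y : ZMod p) :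
    (p : ℤ_[p]) ∣ ω x + ω y - ω (x + y) := by
  rw [← PadicInt.toZMod_eq_zero_iff_dvd, map_sub, map_add]
  simp only [h.toZMod_apply, sub_self]

variable (K : Type*) [NormedField K] [NormedAlgebra ℚ_[p] K]

/-- The Teichmüller character as a multiplicative character with values in `K`. -/
noncomputable def mulChar (h : IsTeichmuller ω) : MulChar (ZMod p) K where
  toFun x := algebraMap ℚ_[p] K (ω x)
  map_one' := by simp [h.map_one]
  map_mul' x y := by simp [h.map_mul]
  map_nonunit' x hx := by
    have : x = 0 := by simpa using hx
    simp [this, h.map_zero]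

theorem mulChar_apply (h : IsTeichmuller ω) (x : ZMod p) :
    h.mulChar K x = algebraMap ℚ_[p] K (ω x) := rfl

theorem orderOf_mulChar (h : IsTeichmuller ω) : orderOf (h.mulChar K) = p - 1 := by
  refine Nat.dvd_antisymm (orderOf_dvd_of_pow_eq_one ?_) ?_
  · ext u
    rw [MulChar.pow_apply_coe, mulChar_apply, MulChar.one_apply_coe, ← _root_.map_pow]
    have h1 : ω u ^ (p - 1) = 1 := by
      rw [← h.map_pow, ZMod.pow_card_sub_one_eq_one u.ne_zero, h.map_one]
    have h2 : (ω u : ℚ_[p]) ^ (p - 1) = 1 := by exact_mod_cast congrArg ((↑) : ℤ_[p] → ℚ_[p]) h1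
    rw [h2, _root_.map_one]
  · have hall : ∀ u : (ZMod p)ˣ, u ^ orderOf (h.mulChar K) = 1 := fun u => by
      have h1 := congrArg (fun χ : MulChar (ZMod p) K => χ u) (pow_orderOf_eq_one (h.mulChar K))
      simp only [MulChar.pow_apply_coe, MulChar.one_apply_coe, mulChar_apply] at h1
      rw [← _root_.map_pow, ← _root_.map_one (algebraMap ℚ_[p] K)] at h1
      have h2 := (algebraMap ℚ_[p] K).injective h1
      have h3 : ω u ^ orderOf (h.mulChar K) = 1 := by
        apply Subtype.val_injective
        simpa using h2
      rw [← h.map_pow, ← h.map_one] at h3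
      exact Units.ext (by simpa using h.injective h3)
    have := (FiniteField.forall_pow_eq_one_iff (ZMod p) _).1 hall
    rwa [ZMod.card] at this

end IsTeichmuller

end teichmuller

section additiveCharacter

open PowerSeries

variable {p : ℕ} [hp : Fact p.Prime] {ω : ZMod p → ℤ_[p]} {K : Type*} [NormedField K]
  [NormedAlgebra ℚ_[p] K]

theorem norm_of_pow_eq_neg_prime {π : K} (hπ : π ^ (p - 1) = algebraMap ℚ_[p] K (-p)) :
    ‖π‖ = dworkRadius p ^ 2 := by
  have h := congrArg norm hπ
  rw [norm_pow, norm_algebraMap', norm_neg, Padic.norm_p, ← dworkRadius_pow, pow_mul] at h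
  have := hp.out.two_le
  exact (pow_left_inj₀ (norm_nonneg _) (by have := dworkRadius_pos p; positivity) (by omega)).1 h

theorem norm_mul_padicInt_le {π : K} (hπ : π ^ (p - 1) = algebraMap ℚ_[p] K (-p))
    (w : ℤ_[p]) : ‖π * algebraMap ℚ_[p] K w‖ ≤ dworkRadius p ^ 2 := by
  rw [norm_mul, norm_of_pow_eq_neg_prime hπ, norm_algebraMap']
  exact mul_le_of_le_one_right (by have := dworkRadius_pos p; positivity) (PadicInt.norm_le_one _)

namespace IsTeichmuller

variable [CompleteSpace K]

theorem tsumEval_pow_prime (h : IsTeichmuller ω) (hp3 : 3 < p) {π : K}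
    (hπ : π ^ (p - 1) = algebraMap ℚ_[p] K (-p)) (x : ZMod p) :
    (dworkSeries p).tsumEval (π * algebraMap ℚ_[p] K (ω x)) ^ p = 1 := by
  refine tsumEval_dworkSeries_pow hp3 (norm_mul_padicInt_le hπ (ω x)) ?_
  have h1 : π ^ p = algebraMap ℚ_[p] K (-p) * π := by
    rw [← hπ, ← pow_succ, Nat.sub_add_cancel hp.out.one_le]
  have h2 : (ω x : ℚ_[p]) ^ p = ω x := by
    exact_mod_cast congrArg ((↑) : ℤ_[p] → ℚ_[p]) (h.pow_prime x)
  rw [mul_pow, h1, ← _root_.map_pow, h2, mul_assoc]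

variable [IsUltrametricDist K]

theorem tsumEval_add (h : IsTeichmuller ω) (hp3 : 3 < p) {π : K}
    (hπ : π ^ (p - 1) = algebraMap ℚ_[p] K (-p)) (x y : ZMod p) :
    (dworkSeries p).tsumEval (π * algebraMap ℚ_[p] K (ω (x + y))) =
      (dworkSeries p).tsumEval (π * algebraMap ℚ_[p] K (ω x)) *
        (dworkSeries p).tsumEval (π * algebraMap ℚ_[p] K (ω y)) := by
  have hr0 := dworkRadius_pos p
  have hr1 := (dworkRadius_lt_one p).le
  have hnorm : ∀ x, ‖(dworkSeries p).tsumEval (π * algebraMap ℚ_[p] K (ω x))‖ = 1 := fun x => by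
    have := congrArg norm (h.tsumEval_pow_prime hp3 hπ x)
    rw [norm_pow, norm_one] at this
    exact (pow_eq_one_iff_of_nonneg (norm_nonneg _) hp.out.ne_zero).1 this
  have hx := norm_tsumEval_dworkSeries_sub_le hp3 (norm_mul_padicInt_le hπ (ω x))
  have hy := norm_tsumEval_dworkSeries_sub_le hp3 (norm_mul_padicInt_le hπ (ω y))
  have hxy := norm_tsumEval_dworkSeries_sub_le hp3 (norm_mul_padicInt_le hπ (ω (x + y)))
  have hax := norm_mul_padicInt_le hπ (ω x)
  have hay := norm_mul_padicInt_le hπ (ω y)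
  have hsum : ‖π * algebraMap ℚ_[p] K (ω x) + π * algebraMap ℚ_[p] K (ω y) -
      π * algebraMap ℚ_[p] K (ω (x + y))‖ ≤ dworkRadius p ^ 3 := by
    obtain ⟨c, hc⟩ := h.dvd_add_sub x y
    have hc' : (ω x : ℚ_[p]) + ω y - ω (x + y) = p * c := by
      exact_mod_cast congrArg ((↑) : ℤ_[p] → ℚ_[p]) hc
    rw [← mul_add, ← mul_sub, ← map_add, ← map_sub, hc', norm_mul, norm_algebraMap', norm_mul,
      norm_of_pow_eq_neg_prime hπ, Padic.norm_p, ← dworkRadius_pow]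
    calc _ ≤ dworkRadius p ^ 2 * (dworkRadius p ^ (2 * (p - 1)) * 1) := by
          gcongr; exact PadicInt.norm_le_one c
      _ = dworkRadius p ^ (2 + 2 * (p - 1)) := by rw [mul_one, pow_add]
      _ ≤ _ := pow_le_pow_of_le_one hr0.le hr1 (by omega)
  have hzx := h.tsumEval_pow_prime hp3 hπ x
  have hzy := h.tsumEval_pow_prime hp3 hπ y
  have hzxy := h.tsumEval_pow_prime hp3 hπ (x + y)
  have hnx := hnorm x
  have hny := hnorm y
  have hnxy := hnorm (x + y)
  generalize (dworkSeries p).tsumEval (π * algebraMap ℚ_[p] K (ω x)) = u at *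
  generalize (dworkSeries p).tsumEval (π * algebraMap ℚ_[p] K (ω y)) = v at *
  generalize (dworkSeries p).tsumEval (π * algebraMap ℚ_[p] K (ω (x + y))) = w at *
  generalize π * algebraMap ℚ_[p] K (ω x) = a at *
  generalize π * algebraMap ℚ_[p] K (ω y) = b at *
  generalize π * algebraMap ℚ_[p] K (ω (x + y)) = c at *
  have hw0 : w ≠ 0 := by rw [← norm_ne_zero_iff, hnxy]; exact one_ne_zero
  have hr2 : dworkRadius p ^ 2 ≤ 1 := pow_le_one₀ hr0.le hr1
  have hle : ‖u * v - w‖ ≤ dworkRadius p ^ 3 := by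
    have e : u * v - w = (u - 1 - a) * v + (v - 1 - b) + a * (v - 1 - b) + (a + b - c) + a * b -
        (w - 1 - c) := by ring
    have hadd : ∀ {s t : K}, ‖s‖ ≤ dworkRadius p ^ 3 → ‖t‖ ≤ dworkRadius p ^ 3 →
        ‖s + t‖ ≤ dworkRadius p ^ 3 := fun hs ht =>
      (IsUltrametricDist.norm_add_le_max _ _).trans (max_le hs ht)
    rw [e, sub_eq_add_neg _ (w - 1 - c)]
    refine hadd (hadd (hadd (hadd (hadd ?_ hy) ?_) hsum) ?_) (by rwa [norm_neg])
    · rwa [norm_mul, hny, mul_one]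
    · rw [norm_mul]
      exact (mul_le_of_le_one_left (norm_nonneg _) (hax.trans hr2)).trans hy
    · rw [norm_mul]
      calc _ ≤ dworkRadius p ^ 2 * dworkRadius p ^ 2 := by gcongr
        _ = dworkRadius p ^ 4 := by ring
        _ ≤ _ := pow_le_pow_of_le_one hr0.le hr1 (by norm_num)
  have hone : u * v / w = 1 := by
    refine eq_one_of_pow_prime_eq_one hp.out (by rw [div_pow, mul_pow, hzx, hzy, hzxy]; simp) ?_
    rw [div_sub_one hw0, norm_div, hnxy, div_one]
    have hpn : ‖(p : K)‖ = dworkRadius p ^ (2 * (p - 1)) := by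
      rw [← map_natCast (algebraMap ℚ_[p] K), norm_algebraMap', Padic.norm_p, dworkRadius_pow]
    rw [hpn]
    calc _ ≤ (dworkRadius p ^ 3) ^ (p - 1) := by gcongr
      _ = dworkRadius p ^ (3 * (p - 1)) := by rw [pow_mul]
      _ < _ := pow_lt_pow_right_of_lt_one₀ hr0 (dworkRadius_lt_one p) (by omega)
  exact ((div_eq_one_iff_eq hw0).1 hone).symm

/-- The additive character of `𝔽_p` attached by Dwork to a root of `X ^ (p - 1) + p`. -/
noncomputable def dworkAddChar (h : IsTeichmuller ω) (hp3 : 3 < p) {π : K}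
    (hπ : π ^ (p - 1) = algebraMap ℚ_[p] K (-p)) : AddChar (ZMod p) K where
  toFun x := (dworkSeries p).tsumEval (π * algebraMap ℚ_[p] K (ω x))
  map_zero_eq_one' := by
    have h1 := h.tsumEval_add hp3 hπ 0 0
    rw [add_zero] at h1
    have h0 : (dworkSeries p).tsumEval (π * algebraMap ℚ_[p] K (ω 0)) ≠ 0 := fun h0 => by
      have := h.tsumEval_pow_prime hp3 hπ 0
      rw [h0, zero_pow hp.out.ne_zero] at this
      exact zero_ne_one this
    exact (mul_left_cancel₀ h0 (by rw [mul_one]; exact h1)).symm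
  map_add_eq_mul' := h.tsumEval_add hp3 hπ

theorem dworkAddChar_apply (h : IsTeichmuller ω) (hp3 : 3 < p) {π : K}
    (hπ : π ^ (p - 1) = algebraMap ℚ_[p] K (-p)) (x : ZMod p) :
    h.dworkAddChar hp3 hπ x = (dworkSeries p).tsumEval (π * algebraMap ℚ_[p] K (ω x)) := rfl

theorem dworkAddChar_ne_one (h : IsTeichmuller ω) (hp3 : 3 < p) {π : K}
    (hπ : π ^ (p - 1) = algebraMap ℚ_[p] K (-p)) : h.dworkAddChar hp3 hπ ≠ 1 := by
  intro h1
  have h2 := norm_tsumEval_dworkSeries_sub_le hp3 (norm_mul_padicInt_le hπ (ω 1))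
  rw [← h.dworkAddChar_apply hp3 hπ, h1, AddChar.one_apply, sub_self, zero_sub, norm_neg, norm_mul,
    norm_of_pow_eq_neg_prime hπ, h.map_one] at h2
  have h3 := pow_lt_pow_right_of_lt_one₀ (dworkRadius_pos p) (dworkRadius_lt_one p)
    (show 2 < 3 by norm_num)
  rw [PadicInt.coe_one, _root_.map_one, norm_one, mul_one] at h2
  exact absurd h2 (not_le.2 h3)

theorem dworkAddChar_isPrimitive (h : IsTeichmuller ω) (hp3 : 3 < p) {π : K}
    (hπ : π ^ (p - 1) = algebraMap ℚ_[p] K (-p)) : (h.dworkAddChar hp3 hπ).IsPrimitive :=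
  AddChar.IsPrimitive.of_ne_one (h.dworkAddChar_ne_one hp3 hπ)

/-- The Gross–Koblitz formula over `𝔽_p`. -/
theorem gaussSum_mulChar_inv_pow (h : IsTeichmuller ω) (hp3 : 3 < p) {π : K}
    (hπ : π ^ (p - 1) = algebraMap ℚ_[p] K (-p)) {Γ : ℤ_[p] → ℤ_[p]} (hΓ : IsMoritaGamma Γ)
    {a : ℕ} (ha : a < p - 1) {X : ℤ_[p]} (hX : ((p : ℤ_[p]) - 1) * X = a) :
    gaussSum ((h.mulChar K) ^ a)⁻¹ (h.dworkAddChar hp3 hπ) =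
      -π ^ a * algebraMap ℚ_[p] K (Γ X) := by
  set c : ℕ → K := fun n => algebraMap ℚ_[p] K (dworkCoeff p n) * π ^ n with hc
  set χ : ℕ → MulChar (ZMod p) K := fun n => ((h.mulChar K) ^ a)⁻¹ * (h.mulChar K) ^ n with hχ
  have hsum : ∀ x : ZMod p, Summable fun n => c n * χ n x := by
    intro x
    rcases eq_or_ne x 0 with rfl | hx
    · simp only [MulChar.map_zero, mul_zero]
      exact summable_zero
    · obtain ⟨u, rfl⟩ := hx.isUnit
      have h1 := ((dworkSeries_summableAt hp3 (norm_mul_padicInt_le hπ (ω u))).of_norm).mul_left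
        (((h.mulChar K) ^ a)⁻¹ u)
      refine h1.congr fun n => ?_
      simp only [hc, hχ, MulChar.mul_apply, MulChar.pow_apply_coe, mulChar_apply, mul_pow, dworkCoeff]
      ring
  have hterm : ∀ x : ZMod p, ((h.mulChar K) ^ a)⁻¹ x * h.dworkAddChar hp3 hπ x =
      ∑' n, c n * χ n x := by
    intro x
    rcases eq_or_ne x 0 with rfl | hx
    · simp only [MulChar.map_zero, mul_zero, zero_mul, tsum_zero]
    · obtain ⟨u, rfl⟩ := hx.isUnit
      rw [dworkAddChar_apply, tsumEval, ← tsum_mul_left]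
      refine tsum_congr fun n => ?_
      simp only [hc, hχ, MulChar.mul_apply, MulChar.pow_apply_coe, mulChar_apply, mul_pow, dworkCoeff]
      ring
  rw [gaussSum, Finset.sum_congr rfl fun x _ => hterm x,
    ← Summable.tsum_finsetSum fun x _ => hsum x]
  simp only [← Finset.mul_sum]
  have hp1 : 0 < p - 1 := by omega
  have hinj : Function.Injective fun m : ℕ => (p - 1) * m + a := fun m m' hmm => by
    have : (p - 1) * m = (p - 1) * m' := by simpa using hmm
    exact Nat.eq_of_mul_eq_mul_left hp1 this
  rw [← hinj.tsum_eq]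
  · have hone : ∀ m, χ ((p - 1) * m + a) = 1 := fun m => by
      simp only [hχ]
      rw [pow_add, pow_mul, ← h.orderOf_mulChar K, pow_orderOf_eq_one, one_pow, one_mul,
        inv_mul_cancel]
    have hterm2 : ∀ m, c ((p - 1) * m + a) * ∑ x, χ ((p - 1) * m + a) x =
        (((p : K) - 1) * π ^ a) *
          algebraMap ℚ_[p] K ((-(p : ℚ_[p])) ^ m * dworkCoeff p ((p - 1) * m + a)) := fun m => by
      rw [hone, MulChar.sum_one_eq_card_units, ZMod.card_units]
      simp only [hc]
      rw [Nat.cast_sub hp.out.one_le, pow_add, pow_mul, hπ, _root_.map_mul, _root_.map_pow,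
        Nat.cast_one]
      ring
    rw [tsum_congr hterm2, tsum_mul_left]
    have hs : Summable fun m : ℕ => (-(p : ℚ_[p])) ^ m * dworkCoeff p ((p - 1) * m + a) := by
      refine Summable.of_norm_bounded
        (summable_geometric_dworkRadius p hp3 (((dworkRadius p)⁻¹) ^ a)) fun m => ?_
      have := norm_p_pow_mul_dworkCoeff_le p hp3 (a := a) (n := m) (m := (p - 1) * m + a)
        (by gcongr; omega)
      simpa using this
    rw [← hs.map_tsum _ (continuous_algebraMap ℚ_[p] K)]
    rw [← hΓ.one_sub_mul_tsum_dworkCoeff hp3 (show a < p by omega) X hX, _root_.map_mul, map_sub,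
      map_natCast, _root_.map_one]
    ring
  · intro n hn
    by_contra hd
    refine hn ?_
    beta_reduce
    rw [MulChar.sum_eq_zero_of_ne_one, mul_zero]
    intro h1
    have h2 : (h.mulChar K) ^ n = (h.mulChar K) ^ a := by
      simp only [hχ] at h1
      exact (inv_mul_eq_one.1 h1).symm
    rw [pow_eq_pow_iff_modEq, orderOf_mulChar] at h2
    refine hd ⟨n / (p - 1), ?_⟩
    have h3 : n % (p - 1) = a := by rw [h2, Nat.mod_eq_of_lt ha]
    simp only
    rw [← h3]; exact Nat.div_add_mod n (p - 1)

end IsTeichmuller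

end additiveCharacter

section characterSum

variable {F : Type*} [Field F] [Fintype F] {K : Type*} [Field K]

theorem sum_mulChar_mul_addChar_mul (χ : MulChar F K) (ψ : AddChar F K) {z : F} (hz : z ≠ 0) :
    ∑ x, χ x * ψ (z * x) = χ⁻¹ z * gaussSum χ ψ := by
  have h := gaussSum_mulShift χ ψ (Units.mk0 z hz)
  rw [Units.val_mk0] at h
  have hu : IsUnit (χ z) := (Ne.isUnit hz).map χ
  rw [← h, ← mul_assoc, ← MulChar.mul_apply, inv_mul_cancel, MulChar.one_apply (Ne.isUnit hz), one_mul]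
  rfl

theorem gaussSum_mul_gaussSum_inv (χ : MulChar F K) (hχ : χ ≠ 1) {ψ : AddChar F K}
    (hψ : ψ.IsPrimitive) :
    gaussSum χ ψ * gaussSum χ⁻¹ ψ = χ (-1) * Fintype.card F := by
  have h1 := gaussSum_mul_gaussSum_eq_card hχ hψ
  have h2 := mul_gaussSum_inv_eq_gaussSum χ⁻¹ ψ
  have h3 : χ⁻¹ (-1) = χ (-1) := by
    rw [MulChar.inv_apply', inv_neg_one]
  rw [← h2, h3, ← h1]
  ring

theorem sum_sum_trinomial {φ : MulChar F K} (hφ : φ.IsQuadratic) (hφ1 : φ ≠ 1) (χ : MulChar F K)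
    (ψ : AddChar F K) :
    gaussSum φ ψ * ∑ x, ∑ s, (χ ^ 3) x * χ⁻¹ s * φ (1 + x + s) =
      gaussSum (χ ^ 3) ψ * gaussSum χ⁻¹ ψ * gaussSum (φ * χ⁻¹ ^ 2) ψ := by
  have hφg : ∀ w : F, gaussSum φ ψ * φ w = ∑ z, φ z * ψ (w * z) := by
    intro w
    rcases eq_or_ne w 0 with rfl | hw
    · simp [MulChar.sum_eq_zero_of_ne_one hφ1, MulChar.map_zero]
    · rw [sum_mulChar_mul_addChar_mul φ ψ hw, hφ.inv, mul_comm]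
  have h1 : gaussSum φ ψ * ∑ x, ∑ s, (χ ^ 3) x * χ⁻¹ s * φ (1 + x + s) =
      ∑ x, ∑ s, ∑ z, φ z * ψ z * ((χ ^ 3) x * ψ (z * x)) * (χ⁻¹ s * ψ (z * s)) := by
    simp only [Finset.mul_sum]
    refine Finset.sum_congr rfl fun x _ => Finset.sum_congr rfl fun s _ => ?_
    rw [mul_left_comm, hφg, Finset.mul_sum]
    refine Finset.sum_congr rfl fun z _ => ?_
    rw [show (1 + x + s) * z = z + z * x + z * s by ring, AddChar.map_add_eq_mul,
      AddChar.map_add_eq_mul]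
    ring
  have h2 : ∑ x, ∑ s, ∑ z, φ z * ψ z * ((χ ^ 3) x * ψ (z * x)) * (χ⁻¹ s * ψ (z * s)) =
      ∑ z, φ z * ψ z * (∑ x, (χ ^ 3) x * ψ (z * x)) * ∑ s, χ⁻¹ s * ψ (z * s) := by
    rw [Finset.sum_congr rfl fun x _ => Finset.sum_comm, Finset.sum_comm]
    refine Finset.sum_congr rfl fun z _ => ?_
    rw [mul_assoc, Finset.sum_mul_sum, Finset.mul_sum]
    refine Finset.sum_congr rfl fun x _ => ?_
    rw [Finset.mul_sum]
    refine Finset.sum_congr rfl fun s _ => ?_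
    ring
  rw [h1, h2]
  rw [show gaussSum (φ * χ⁻¹ ^ 2) ψ = ∑ z, (φ * χ⁻¹ ^ 2) z * ψ z from rfl, Finset.mul_sum]
  refine Finset.sum_congr rfl fun z _ => ?_
  rcases eq_or_ne z 0 with rfl | hz
  · simp [MulChar.map_zero]
  · rw [sum_mulChar_mul_addChar_mul _ ψ hz, sum_mulChar_mul_addChar_mul _ ψ hz, inv_inv]
    have h3 : (φ * χ⁻¹ ^ 2) z = φ z * ((χ ^ 3)⁻¹ z * χ z) := by
      rw [← MulChar.mul_apply, ← MulChar.mul_apply]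
      congr 2
      group
    rw [h3]; ring

/-- The Mellin transform of the family of sums `∑ x, φ (1 + x + c * t * x ^ 3)` in terms of Gauss
sums. -/
theorem gaussSum_mul_sum_trinomial {φ : MulChar F K} (hφ : φ.IsQuadratic) (hφ1 : φ ≠ 1)
    (χ : MulChar F K) {ψ : AddChar F K} (hψ : ψ.IsPrimitive) {c : F} (hc : c ≠ 0) :
    gaussSum φ ψ * gaussSum χ ψ * ∑ t, χ⁻¹ t * ∑ x, φ (1 + x + c * t * x ^ 3) =
      Fintype.card F * χ (-c) * gaussSum (χ ^ 3) ψ * gaussSum (φ * χ⁻¹ ^ 2) ψ := by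
  classical
  have hψ1 : ψ ≠ 1 := by simpa using hψ one_ne_zero
  have h1 : ∑ t, χ⁻¹ t * ∑ x, φ (1 + x + c * t * x ^ 3) =
      ∑ t, χ⁻¹ t + χ c * ∑ x, ∑ s, (χ ^ 3) x * χ⁻¹ s * φ (1 + x + s) := by
    simp only [Finset.mul_sum]
    rw [Finset.sum_comm, ← Finset.add_sum_erase _ _ (Finset.mem_univ (0 : F)),
      ← Finset.add_sum_erase (a := (0 : F)) (f := fun x => ∑ s, χ c * ((χ ^ 3) x * χ⁻¹ s * φ (1 + x + s))) _ (Finset.mem_univ _)]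
    have h0 : ∑ s, χ c * ((χ ^ 3) 0 * χ⁻¹ s * φ (1 + 0 + s)) = 0 := by
      simp [MulChar.map_zero]
    rw [h0, zero_add]
    congr 1
    · simp
    · refine Finset.sum_congr rfl fun x hx => ?_
      have hx : x ≠ 0 := (Finset.mem_erase.1 hx).1
      have hcx : c * x ^ 3 ≠ 0 := mul_ne_zero hc (pow_ne_zero 3 hx)
      symm
      rw [← Equiv.sum_comp (Equiv.mulLeft₀ _ hcx)]
      refine Finset.sum_congr rfl fun t _ => ?_
      rw [Equiv.mulLeft₀_apply]
      beta_reduce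
      rw [show c * t * x ^ 3 = c * x ^ 3 * t by ring, map_mul, map_mul, map_pow,
        MulChar.pow_apply' _ (by norm_num)]
      have h2 : ∀ {y : F}, y ≠ 0 → χ y * χ⁻¹ y = 1 := fun hy => by
        rw [← MulChar.mul_apply, mul_inv_cancel, MulChar.one_apply (Ne.isUnit hy)]
      have h3 := h2 hc
      have h4 : χ x ^ 3 * χ⁻¹ x ^ 3 = 1 := by rw [← mul_pow, h2 hx, one_pow]
      linear_combination (χ⁻¹ t * φ (1 + x + c * x ^ 3 * t)) * h3 +
        χ c * χ⁻¹ c * χ⁻¹ t * φ (1 + x + c * x ^ 3 * t) * h4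
  have h2 := sum_sum_trinomial hφ hφ1 χ ψ
  rw [h1]
  rcases eq_or_ne χ 1 with rfl | hχ
  · rw [inv_one, one_pow, one_pow, mul_one, gaussSum_one_left hψ1] at *
    rw [MulChar.sum_one_eq_card_units, MulChar.one_apply (Ne.isUnit hc),
      MulChar.one_apply (Ne.isUnit (neg_ne_zero.2 hc)), Fintype.card_units,
      Nat.cast_sub Fintype.card_pos, Nat.cast_one]
    linear_combination (-1 : K) * h2
  · have hχ' : χ⁻¹ ≠ 1 := by simpa using hχ
    rw [MulChar.sum_eq_zero_of_ne_one hχ', zero_add]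
    have h3 := gaussSum_mul_gaussSum_inv χ hχ hψ
    rw [show -c = -1 * c by ring, map_mul]
    linear_combination gaussSum χ ψ * χ c * h2 +
      χ c * gaussSum (χ ^ 3) ψ * gaussSum (φ * χ⁻¹ ^ 2) ψ * h3

end characterSum

section fract

theorem Int.fract_floor_of_eq_add {q f : ℚ} {k : ℤ} (h : q = k + f) (h0 : 0 ≤ f) (h1 : f < 1) :
    Int.fract q = f ∧ ⌊q⌋ = k := by
  have h2 : ⌊q⌋ = k := Int.floor_eq_iff.2 ⟨by linarith, by linarith⟩
  exact ⟨by rw [Int.fract, h2]; linarith, h2⟩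

variable {M : Type*} [CommMonoid M] (G : ℚ → M)

theorem Int.fract_mul_fract_add_half {r x : ℚ} {e : ℤ} (h : 2 * r = e + x) (h0 : 0 ≤ x)
    (h1 : x < 1) :
    G (Int.fract r) * G (Int.fract (r + 1 / 2)) = G (x / 2) * G ((x + 1) / 2) ∧
      ⌊r⌋ + ⌊r + 1 / 2⌋ = e := by
  obtain ⟨k, rfl | rfl⟩ := e.even_or_odd'
  · push_cast at h
    obtain ⟨a1, a2⟩ := Int.fract_floor_of_eq_add (q := r) (f := x / 2) (k := k)
      (by linarith) (by linarith) (by linarith)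
    obtain ⟨b1, b2⟩ := Int.fract_floor_of_eq_add (q := r + 1 / 2) (f := (x + 1) / 2) (k := k)
      (by linarith) (by linarith) (by linarith)
    rw [a1, a2, b1, b2]
    exact ⟨rfl, by ring⟩
  · push_cast at h
    obtain ⟨a1, a2⟩ := Int.fract_floor_of_eq_add (q := r) (f := (x + 1) / 2) (k := k)
      (by linarith) (by linarith) (by linarith)
    obtain ⟨b1, b2⟩ := Int.fract_floor_of_eq_add (q := r + 1 / 2) (f := x / 2) (k := k + 1)
      (by push_cast; linarith) (by linarith) (by linarith)
    rw [a1, a2, b1, b2]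
    exact ⟨mul_comm _ _, by ring⟩

theorem Int.fract_mul_fract_add_thirds {r x : ℚ} {e : ℤ} (h : 3 * r = e + x) (h0 : 0 ≤ x)
    (h1 : x < 1) :
    G (Int.fract r) * (G (Int.fract (r + 1 / 3)) * G (Int.fract (r + 2 / 3))) =
        G (x / 3) * (G ((x + 1) / 3) * G ((x + 2) / 3)) ∧
      ⌊r⌋ + ⌊r + 1 / 3⌋ + ⌊r + 2 / 3⌋ = e := by
  obtain ⟨k, he⟩ : ∃ k : ℤ, e = 3 * k ∨ e = 3 * k + 1 ∨ e = 3 * k + 2 := ⟨e / 3, by omega⟩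
  rcases he with rfl | rfl | rfl <;> push_cast at h
  · obtain ⟨a1, a2⟩ := Int.fract_floor_of_eq_add (q := r) (f := x / 3) (k := k)
      (by linarith) (by linarith) (by linarith)
    obtain ⟨b1, b2⟩ := Int.fract_floor_of_eq_add (q := r + 1 / 3) (f := (x + 1) / 3) (k := k)
      (by linarith) (by linarith) (by linarith)
    obtain ⟨c1, c2⟩ := Int.fract_floor_of_eq_add (q := r + 2 / 3) (f := (x + 2) / 3) (k := k)
      (by linarith) (by linarith) (by linarith)
    rw [a1, a2, b1, b2, c1, c2]
    exact ⟨rfl, by ring⟩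
  · obtain ⟨a1, a2⟩ := Int.fract_floor_of_eq_add (q := r) (f := (x + 1) / 3) (k := k)
      (by linarith) (by linarith) (by linarith)
    obtain ⟨b1, b2⟩ := Int.fract_floor_of_eq_add (q := r + 1 / 3) (f := (x + 2) / 3) (k := k)
      (by linarith) (by linarith) (by linarith)
    obtain ⟨c1, c2⟩ := Int.fract_floor_of_eq_add (q := r + 2 / 3) (f := x / 3) (k := k + 1)
      (by push_cast; linarith) (by linarith) (by linarith)
    rw [a1, a2, b1, b2, c1, c2]
    exact ⟨by rw [mul_comm (G (x / 3)), mul_assoc], by ring⟩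
  · obtain ⟨a1, a2⟩ := Int.fract_floor_of_eq_add (q := r) (f := (x + 2) / 3) (k := k)
      (by linarith) (by linarith) (by linarith)
    obtain ⟨b1, b2⟩ := Int.fract_floor_of_eq_add (q := r + 1 / 3) (f := x / 3) (k := k + 1)
      (by push_cast; linarith) (by linarith) (by linarith)
    obtain ⟨c1, c2⟩ := Int.fract_floor_of_eq_add (q := r + 2 / 3) (f := (x + 1) / 3) (k := k + 1)
      (by push_cast; linarith) (by linarith) (by linarith)
    rw [a1, a2, b1, b2, c1, c2]
    exact ⟨by rw [mul_comm, mul_assoc], by ring⟩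

end fract

section toZp

variable {p : ℕ} [hp : Fact p.Prime]

theorem coe_toZp {q : ℚ} (h : ‖(q : ℚ_[p])‖ ≤ 1) : (toZp p q : ℚ_[p]) = q := by
  have h1 : toZp p q = ⟨(q : ℚ_[p]), h⟩ := dif_pos h
  rw [h1]

theorem natCast_mul_toZp {q r : ℚ} (m : ℕ) (hq : ‖(q : ℚ_[p])‖ ≤ 1) (hr : ‖(r : ℚ_[p])‖ ≤ 1)
    (h : m * q = r) : (m : ℤ_[p]) * toZp p q = toZp p r := by
  apply Subtype.val_injective
  rw [PadicInt.coe_mul, coe_toZp hq, coe_toZp hr, ← h]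
  push_cast; rfl

theorem norm_div_natCast_le {q : ℚ} (hq : ‖(q : ℚ_[p])‖ ≤ 1) {m : ℕ} (hm : ¬ p ∣ m) :
    ‖((q / m : ℚ) : ℚ_[p])‖ ≤ 1 := by
  push_cast
  rw [norm_div, Padic.norm_natCast_eq_one_iff.2 ((hp.out.coprime_iff_not_dvd).2 hm), div_one]
  exact hq

theorem norm_add_natCast_le {q : ℚ} (hq : ‖(q : ℚ_[p])‖ ≤ 1) (i : ℕ) :
    ‖((q + i : ℚ) : ℚ_[p])‖ ≤ 1 := by
  push_cast
  exact (IsUltrametricDist.norm_add_le_max _ _).trans (max_le hq (by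
    simpa using Padic.norm_int_le_one (p := p) i))

theorem toZp_one : toZp p 1 = 1 := by
  apply Subtype.val_injective
  rw [coe_toZp (by simp)]; simp

theorem toZp_add_div {q : ℚ} (hq : ‖(q : ℚ_[p])‖ ≤ 1) {m : ℕ} (hm : ¬ p ∣ m) (i : ℕ) :
    toZp p ((q + i) / m) = toZp p (1 / m) * (toZp p q + i) := by
  apply Subtype.val_injective
  rw [coe_toZp (norm_div_natCast_le (norm_add_natCast_le hq i) hm), PadicInt.coe_mul,
    coe_toZp (norm_div_natCast_le (by simp) hm), PadicInt.coe_add, coe_toZp hq]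
  push_cast
  ring

theorem not_dvd_sub_one : ¬ p ∣ p - 1 := fun h => by
  have := hp.out.one_lt
  have := Nat.le_of_dvd (by omega) h
  omega

theorem norm_natCast_div_le (a : ℕ) : ‖((a / (p - 1 : ℕ) : ℚ) : ℚ_[p])‖ ≤ 1 :=
  norm_div_natCast_le (by simpa using Padic.norm_int_le_one (p := p) a) not_dvd_sub_one

theorem sub_one_mul_toZp (a : ℕ) :
    ((p : ℤ_[p]) - 1) * toZp p (a / (p - 1 : ℕ)) = a := by
  have hp1 := hp.out.one_lt
  have h0 : ((p - 1 : ℕ) : ℚ) ≠ 0 := by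
    have : p - 1 ≠ 0 := by omega
    exact_mod_cast this
  have ha : ‖((a : ℚ) : ℚ_[p])‖ ≤ 1 := by simpa using Padic.norm_int_le_one (p := p) a
  have h := natCast_mul_toZp (p := p) (p - 1) (norm_natCast_div_le a) (r := a) ha
    (mul_div_cancel₀ _ h0)
  rw [Nat.cast_sub hp1.le, Nat.cast_one] at h
  rw [h]
  apply Subtype.val_injective
  rw [coe_toZp ha]; simp

variable {Γ : ℤ_[p] → ℤ_[p]} {ω : ZMod p → ℤ_[p]}

theorem IsMoritaGamma.prod_toZp (hΓ : IsMoritaGamma Γ) (hω : IsTeichmuller ω) {m : ℕ}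
    (hm : ¬ p ∣ m) (hm0 : m ≠ 0) {a : ℕ} (ha : a < p) :
    ∏ i ∈ Finset.range m, Γ (toZp p ((a / (p - 1 : ℕ) + i) / m)) =
      ω m ^ a * (∏ i ∈ Finset.range m, Γ (toZp p (i / m))) * Γ (toZp p (a / (p - 1 : ℕ))) := by
  have hu : (m : ℤ_[p]) * toZp p (1 / m) = 1 := by
    rw [natCast_mul_toZp m (norm_div_natCast_le (by simp) hm) (r := 1) (by simp)
      (mul_div_cancel₀ _ (by exact_mod_cast hm0)), toZp_one]
  have h := hΓ.prod_map_mul_add hu (hω.pow_prime m) (hω.dvd_natCast_sub m) ha (sub_one_mul_toZp a)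
  simp only [toZp_add_div (norm_natCast_div_le a) hm]
  rw [h]
  have h0 : ∀ i : ℕ, toZp p (i / m) = toZp p (1 / m) * i := fun i => by
    have := toZp_add_div (p := p) (q := 0) (by simp) hm i
    have hz : toZp p 0 = 0 := by
      apply Subtype.val_injective
      rw [coe_toZp (by simp)]; simp
    rwa [zero_add, hz, zero_add] at this
  simp only [h0]

end toZp

section term

variable {p : ℕ} [hp : Fact p.Prime] {Γ : ℤ_[p] → ℤ_[p]} {ω : ZMod p → ℤ_[p]}

theorem IsMoritaGamma.fract_mul_fract_add_half (hΓ : IsMoritaGamma Γ) (hω : IsTeichmuller ω)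
    (hp3 : 3 < p) {r : ℚ} {e : ℤ} {a : ℕ} (ha : a < p - 1) (h : 2 * r = e + a / (p - 1 : ℕ)) :
    Γ (toZp p (Int.fract r)) * Γ (toZp p (Int.fract (r + 1 / 2))) =
        ω 2 ^ a * (Γ (toZp p 0) * Γ (toZp p (1 / 2))) * Γ (toZp p (a / (p - 1 : ℕ))) ∧
      ⌊r⌋ + ⌊r + 1 / 2⌋ = e := by
  have hN : (0 : ℚ) < (p - 1 : ℕ) := by exact_mod_cast (show 0 < p - 1 by omega)
  have h1 := Int.fract_mul_fract_add_half (fun q => Γ (toZp p q)) h (by positivity)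
    (by rw [div_lt_one hN]; exact_mod_cast ha)
  have h2 := hΓ.prod_toZp hω (m := 2) (fun h => by have := Nat.le_of_dvd (by norm_num) h; omega)
    (by norm_num) (show a < p by omega)
  simp only [Finset.prod_range_succ, Finset.prod_range_zero, one_mul, Nat.cast_zero, Nat.cast_one,
    add_zero, zero_div, Nat.cast_ofNat] at h2
  exact ⟨h1.1.trans h2, h1.2⟩

theorem IsMoritaGamma.fract_mul_fract_add_thirds (hΓ : IsMoritaGamma Γ) (hω : IsTeichmuller ω)
    (hp3 : 3 < p) {r : ℚ} {e : ℤ} {a : ℕ} (ha : a < p - 1) (h : 3 * r = e + a / (p - 1 : ℕ)) :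
    Γ (toZp p (Int.fract r)) * (Γ (toZp p (Int.fract (r + 1 / 3))) *
        Γ (toZp p (Int.fract (r + 2 / 3)))) =
        ω 3 ^ a * (Γ (toZp p 0) * Γ (toZp p (1 / 3)) * Γ (toZp p (2 / 3))) *
          Γ (toZp p (a / (p - 1 : ℕ))) ∧
      ⌊r⌋ + ⌊r + 1 / 3⌋ + ⌊r + 2 / 3⌋ = e := by
  have hN : (0 : ℚ) < (p - 1 : ℕ) := by exact_mod_cast (show 0 < p - 1 by omega)
  have h1 := Int.fract_mul_fract_add_thirds (fun q => Γ (toZp p q)) h (by positivity)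
    (by rw [div_lt_one hN]; exact_mod_cast ha)
  have h2 := hΓ.prod_toZp hω (m := 3) (fun h => by have := Nat.le_of_dvd (by norm_num) h; omega)
    (by norm_num) (show a < p by omega)
  simp only [Finset.prod_range_succ, Finset.prod_range_zero, one_mul, Nat.cast_zero, Nat.cast_one,
    add_zero, zero_div, Nat.cast_ofNat] at h2
  refine ⟨h1.1.trans ?_, h1.2⟩
  rw [← mul_assoc]
  exact h2

/-- The `j`-th term of `₂G₂[1/4, 3/4; 1/3, 2/3]_p`, without the character and the sign. -/
noncomputable def padicGTerm (p : ℕ) [Fact p.Prime] (Γ : ℤ_[p] → ℤ_[p]) (j : ℕ) : ℚ_[p] :=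
  ∏ i : Fin 2,
      ((Γ (toZp p (Int.fract ((![1/4, 3/4] : Fin 2 → ℚ) i - (j : ℚ) / ((p : ℚ) - 1)))) : ℚ_[p]) /
          (Γ (toZp p (Int.fract ((![1/4, 3/4] : Fin 2 → ℚ) i))) : ℚ_[p]) *
        ((Γ (toZp p (Int.fract (-((![1/3, 2/3] : Fin 2 → ℚ) i) + (j : ℚ) / ((p : ℚ) - 1)))) :
            ℚ_[p]) /
          (Γ (toZp p (Int.fract (-((![1/3, 2/3] : Fin 2 → ℚ) i)))) : ℚ_[p])) *
        (-(p : ℚ_[p])) ^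
          (-Int.floor (Int.fract ((![1/4, 3/4] : Fin 2 → ℚ) i) - (j : ℚ) / ((p : ℚ) - 1)) -
            Int.floor (Int.fract (-((![1/3, 2/3] : Fin 2 → ℚ) i)) + (j : ℚ) / ((p : ℚ) - 1))))

theorem padicGTerm_mul (hΓ : IsMoritaGamma Γ) (hω : IsTeichmuller ω)
    (hp3 : 3 < p) {h j b d : ℕ} {e₁ e₂ : ℤ} (hh : 2 * h = p - 1) (hj : j < p - 1)
    (hb : b < p - 1) (hd : d < p - 1) (hb' : (h : ℤ) = b + 2 * j + e₁ * (p - 1 : ℕ))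
    (hd' : 3 * (j : ℤ) = d + e₂ * (p - 1 : ℕ)) :
    padicGTerm p Γ j * ((ω 2 ^ h * Γ (toZp p (h / (p - 1 : ℕ))) *
        Γ (toZp p (j / (p - 1 : ℕ))) : ℤ_[p]) : ℚ_[p]) =
      ((ω 2 ^ b * ω 3 ^ d * Γ (toZp p (b / (p - 1 : ℕ))) * Γ (toZp p (d / (p - 1 : ℕ))) : ℤ_[p]) :
        ℚ_[p]) * (-(p : ℚ_[p])) ^ (-e₁ - e₂) := by
  have hN : (0 : ℚ) < (p - 1 : ℕ) := by exact_mod_cast (show 0 < p - 1 by omega)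
  have hp0 : (-(p : ℚ_[p])) ≠ 0 := neg_ne_zero.2 (by exact_mod_cast hp.out.ne_zero)
  have hpc : ((p - 1 : ℕ) : ℚ) = p - 1 := by rw [Nat.cast_sub hp.out.one_le, Nat.cast_one]
  have hbq : (h : ℚ) = b + 2 * j + e₁ * (p - 1 : ℕ) := by exact_mod_cast hb'
  have hdq : 3 * (j : ℚ) = d + e₂ * (p - 1 : ℕ) := by exact_mod_cast hd'
  have hhq : 2 * (h : ℚ) = (p - 1 : ℕ) := by exact_mod_cast hh
  have hjq : (j : ℚ) < (p - 1 : ℕ) := by exact_mod_cast hj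
  rw [padicGTerm, Fin.prod_univ_two, ← hpc]
  simp only [Matrix.cons_val_zero, Matrix.cons_val_one]
  have f1 : Int.fract (1 / 4 : ℚ) = 1 / 4 := by norm_num [Int.fract_eq_self]
  have f2 : Int.fract (3 / 4 : ℚ) = 3 / 4 := by norm_num [Int.fract_eq_self]
  have f3 : Int.fract (-(1 / 3) : ℚ) = 2 / 3 :=
    Int.fract_eq_iff.2 ⟨by norm_num, by norm_num, -1, by norm_num⟩
  have f4 : Int.fract (-(2 / 3) : ℚ) = 1 / 3 :=
    Int.fract_eq_iff.2 ⟨by norm_num, by norm_num, -1, by norm_num⟩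
  set y : ℚ := j / (p - 1 : ℕ) with hy
  have hyj : y * (p - 1 : ℕ) = j := div_mul_cancel₀ _ hN.ne'
  have hy0 : 0 ≤ y := by positivity
  have hy1 : y < 1 := (div_lt_one hN).2 hjq
  have g1 : Int.fract (-(1 / 3) + y) = Int.fract (y + 2 / 3) := by
    rw [← Int.fract_add_one]; congr 1; ring
  have g2 : Int.fract (-(2 / 3) + y) = Int.fract (y + 1 / 3) := by
    rw [← Int.fract_add_one]; congr 1; ring
  have g3 : (3 / 4 : ℚ) - y = 1 / 4 - y + 1 / 2 := by ring
  rw [f1, f2, f3, f4, g1, g2, g3, add_comm (2 / 3) y, add_comm (1 / 3) y]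
  obtain ⟨A, A'⟩ := hΓ.fract_mul_fract_add_half hω hp3 (r := 1 / 4 - y) (e := e₁) hb (by
    refine mul_right_cancel₀ hN.ne' ?_
    rw [add_mul, div_mul_cancel₀ _ hN.ne']
    linear_combination -2 * hyj - 1 / 2 * hhq + hbq)
  obtain ⟨B, -⟩ := hΓ.fract_mul_fract_add_half hω hp3 (r := 1 / 4) (e := 0) (a := h) (by omega) (by
    refine mul_right_cancel₀ hN.ne' ?_
    rw [add_mul, div_mul_cancel₀ _ hN.ne']
    push_cast
    linear_combination - 1 / 2 * hhq)
  obtain ⟨C, C'⟩ := hΓ.fract_mul_fract_add_thirds hω hp3 (r := y) (e := e₂) hd (by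
    refine mul_right_cancel₀ hN.ne' ?_
    rw [add_mul, div_mul_cancel₀ _ hN.ne']
    linear_combination 3 * hyj + hdq)
  rw [Int.fract_eq_self.2 ⟨hy0, hy1⟩] at C
  rw [Int.floor_eq_zero_iff.2 ⟨hy0, hy1⟩] at C'
  rw [show (1 / 4 + 1 / 2 : ℚ) = 3 / 4 by norm_num, f1, f2] at B
  have hE : -e₁ - e₂ = (-⌊1 / 4 - y⌋ - ⌊y + 2 / 3⌋) + (-⌊1 / 4 - y + 1 / 2⌋ - ⌊y + 1 / 3⌋) := by
    omega
  rw [hE, zpow_add₀ hp0]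
  have hne : ∀ x, (Γ x : ℚ_[p]) ≠ 0 := fun x h => hΓ.ne_zero x (Subtype.val_injective h)
  have A1 := congrArg ((↑) : ℤ_[p] → ℚ_[p]) A
  have B1 := congrArg ((↑) : ℤ_[p] → ℚ_[p]) B
  have C1 := congrArg ((↑) : ℤ_[p] → ℚ_[p]) C
  push_cast at A1 B1 C1 ⊢
  have n1 : (Γ (toZp p 0) : ℚ_[p]) = 1 := by
    have hz : toZp p 0 = 0 := by
      apply Subtype.val_injective
      rw [coe_toZp (by simp)]; simp
    rw [hz, hΓ.map_zero, PadicInt.coe_one]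
  have n2 := hne (toZp p (1 / 2))
  have n3 := hne (toZp p (1 / 3))
  have n4 := hne (toZp p (2 / 3))
  have n5 := hne (toZp p (1 / 4))
  have n6 := hne (toZp p (3 / 4))
  have n7 := hne (toZp p y)
  generalize (-(p : ℚ_[p])) ^ (-⌊1 / 4 - y⌋ - ⌊y + 2 / 3⌋) = P at *
  generalize (-(p : ℚ_[p])) ^ (-⌊1 / 4 - y + 1 / 2⌋ - ⌊y + 1 / 3⌋) = Q at *
  generalize (Γ (toZp p 0) : ℚ_[p]) = v1 at *
  generalize (Γ (toZp p (1 / 2)) : ℚ_[p]) = v2 at *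
  generalize (Γ (toZp p (1 / 3)) : ℚ_[p]) = v3 at *
  generalize (Γ (toZp p (2 / 3)) : ℚ_[p]) = v4 at *
  generalize (Γ (toZp p (1 / 4)) : ℚ_[p]) = v5 at *
  generalize (Γ (toZp p (3 / 4)) : ℚ_[p]) = v6 at *
  generalize (Γ (toZp p y) : ℚ_[p]) = v7 at *
  generalize (Γ (toZp p (Int.fract (1 / 4 - y))) : ℚ_[p]) = a1 at *
  generalize (Γ (toZp p (Int.fract (1 / 4 - y + 1 / 2))) : ℚ_[p]) = a2 at *
  generalize (Γ (toZp p (Int.fract (y + 1 / 3))) : ℚ_[p]) = a3 at *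
  generalize (Γ (toZp p (Int.fract (y + 2 / 3))) : ℚ_[p]) = a4 at *
  generalize (Γ (toZp p (h / (p - 1 : ℕ))) : ℚ_[p]) = b1 at *
  generalize (Γ (toZp p (b / (p - 1 : ℕ))) : ℚ_[p]) = b2 at *
  generalize (Γ (toZp p (d / (p - 1 : ℕ))) : ℚ_[p]) = b3 at *
  generalize (ω 2 : ℚ_[p]) ^ h = w1 at *
  generalize (ω 2 : ℚ_[p]) ^ b = w2 at *
  generalize (ω 3 : ℚ_[p]) ^ d = w3 at *
  have D : (a1 * a2) * (v7 * (a3 * a4)) * (w1 * b1) = w2 * b2 * w3 * b3 * (v3 * v4 * (v5 * v6)) := by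
    rw [A1, B1, C1, n1]
    ring
  field_simp
  linear_combination P * Q * D

end term

section fourier

variable {p : ℕ} [hp : Fact p.Prime] {ω : ZMod p → ℤ_[p]} {K : Type*} [NormedField K]
  [NormedAlgebra ℚ_[p] K]

namespace IsTeichmuller

theorem mulChar_pow_eq_pow (hω : IsTeichmuller ω) {a b : ℕ} (h : a ≡ b [MOD p - 1]) :
    hω.mulChar K ^ a = hω.mulChar K ^ b := by
  rwa [pow_eq_pow_iff_modEq, orderOf_mulChar]

theorem map_neg_one (hω : IsTeichmuller ω) (hp2 : p ≠ 2) : ω (-1) = -1 := by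
  have h1 : ω (-1) * ω (-1) = 1 := by rw [← hω.map_mul, neg_mul_neg, mul_one, hω.map_one]
  refine (mul_self_eq_one_iff.1 h1).resolve_left fun h2 => ?_
  have : Fact (2 < p) := ⟨lt_of_le_of_ne hp.out.two_le hp2.symm⟩
  rw [← hω.map_one] at h2
  exact ZMod.neg_one_ne_one (hω.injective h2)

/-- The Legendre symbol is a power of the Teichmüller character. -/
theorem quadraticChar_eq_mulChar_pow (hω : IsTeichmuller ω) (hp2 : p ≠ 2) :
    (quadraticChar (ZMod p)).ringHomComp (Int.castRingHom K) = hω.mulChar K ^ (p / 2) := by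
  ext u
  have hr : ringChar (ZMod p) ≠ 2 := by rwa [ZMod.ringChar_zmod_n]
  have h1 := quadraticChar_eq_pow_of_char_ne_two' hr (u : ZMod p)
  rw [ZMod.card] at h1
  rw [MulChar.pow_apply_coe, mulChar_apply, ← _root_.map_pow, ← PadicInt.coe_pow, ← hω.map_pow,
    ← h1, MulChar.ringHomComp_apply]
  rcases quadraticChar_dichotomy u.ne_zero with h | h <;> rw [h]
  · simp [hω.map_one]
  · simp [hω.map_neg_one hp2]

theorem sum_inv_mulChar_pow_mul (hω : IsTeichmuller ω) {t : ZMod p} (ht : t ≠ 0)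
    (f : ZMod p → K) :
    ∑ j ∈ Finset.range (p - 1), (hω.mulChar K t)⁻¹ ^ j * ∑ s, (hω.mulChar K ^ j) s * f s =
      (p - 1 : ℕ) * f t := by
  simp only [Finset.mul_sum]
  rw [Finset.sum_comm, Finset.sum_eq_single t]
  · have h0 : hω.mulChar K t ≠ 0 := (ht.isUnit.map (hω.mulChar K)).ne_zero
    rw [Finset.sum_congr rfl fun j _ => ?_, Finset.sum_const, Finset.card_range, nsmul_eq_mul]
    rw [← mul_assoc]
    obtain ⟨u, rfl⟩ := ht.isUnit
    rw [MulChar.pow_apply_coe, ← mul_pow, inv_mul_cancel₀ h0, one_pow, one_mul]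
  · intro s _ hst
    rcases eq_or_ne s 0 with rfl | hs
    · simp [MulChar.map_zero]
    obtain ⟨u, rfl⟩ := hs.isUnit
    simp only [MulChar.pow_apply_coe, ← mul_assoc, ← mul_pow]
    rw [← Finset.sum_mul]
    have hz : (hω.mulChar K t)⁻¹ * hω.mulChar K u = hω.mulChar K (t⁻¹ * u) := by
      rw [_root_.map_mul, ← MulChar.inv_apply', MulChar.inv_apply_eq_inv']
    have hz1 : hω.mulChar K (t⁻¹ * u) ≠ 1 := fun h => by
      have h2 : ω (t⁻¹ * u) = ω 1 := by
        rw [hω.map_one]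
        apply Subtype.val_injective
        apply (algebraMap ℚ_[p] K).injective
        rw [← hω.mulChar_apply K, h]; simp
      have h3 := hω.injective h2
      rw [inv_mul_eq_one₀ ht] at h3
      exact hst h3.symm
    rw [hz, geom_sum_eq hz1, ← _root_.map_pow, ZMod.pow_card_sub_one_eq_one
      (mul_ne_zero (inv_ne_zero ht) hs), _root_.map_one, sub_self, zero_div, zero_mul]
  · simp

variable [CompleteSpace K] [IsUltrametricDist K]

theorem sum_mulChar_pow_mul_trinomial (hω : IsTeichmuller ω) (hp3 : 3 < p) {π : K}
    (hπ : π ^ (p - 1) = algebraMap ℚ_[p] K (-p)) {Γ : ℤ_[p] → ℤ_[p]} (hΓ : IsMoritaGamma Γ)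
    {j : ℕ} (hj : j < p - 1) :
    ∑ t, (hω.mulChar K ^ j) t *
        ∑ x, ((quadraticChar (ZMod p)).ringHomComp (Int.castRingHom K))
          (1 + x + -(4 / 27) * t * x ^ 3) =
      algebraMap ℚ_[p] K (p * padicGTerm p Γ j) := by
  have hp2 : p ≠ 2 := by omega
  have hodd := hp.out.odd_of_ne_two hp2
  obtain ⟨h, hh⟩ : ∃ h, p / 2 = h := ⟨_, rfl⟩
  have hh2 : 2 * h = p - 1 := by obtain ⟨k, hk⟩ := hodd; omega
  have hN : (0 : ℤ) < (p - 1 : ℕ) := by omega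
  obtain ⟨b, hb⟩ := Int.eq_ofNat_of_zero_le (Int.emod_nonneg ((h : ℤ) - 2 * j) hN.ne')
  obtain ⟨d, hd⟩ := Int.eq_ofNat_of_zero_le (Int.emod_nonneg (3 * (j : ℤ)) hN.ne')
  have hbN : b < p - 1 := by have := Int.emod_lt_of_pos ((h : ℤ) - 2 * j) hN; omega
  have hdN : d < p - 1 := by have := Int.emod_lt_of_pos (3 * (j : ℤ)) hN; omega
  have hb1 := Int.emod_add_mul_ediv ((h : ℤ) - 2 * j) (p - 1 : ℕ)
  have hd1 := Int.emod_add_mul_ediv (3 * (j : ℤ)) (p - 1 : ℕ)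
  set e₁ := ((h : ℤ) - 2 * j) / (p - 1 : ℕ)
  set e₂ := (3 * (j : ℤ)) / (p - 1 : ℕ)
  rw [hb] at hb1
  rw [hd] at hd1
  have hT := padicGTerm_mul hΓ hω hp3 hh2 hj hbN hdN (e₁ := e₁) (e₂ := e₂)
    (by linear_combination -hb1) (by linear_combination -hd1)
  have hbm : h ≡ b + 2 * j [MOD p - 1] := by
    refine (Nat.modEq_iff_dvd.2 ⟨-e₁, ?_⟩)
    push_cast; linear_combination hb1
  have hdm : 3 * j ≡ d [MOD p - 1] := by
    refine (Nat.modEq_iff_dvd.2 ⟨-e₂, ?_⟩)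
    push_cast; linear_combination hd1
  have hq := hω.quadraticChar_eq_mulChar_pow (K := K) hp2
  have hpow := fun {m n : ℕ} => hω.mulChar_pow_eq_pow (K := K) (a := m) (b := n)
  have hord := hω.orderOf_mulChar K
  have hG := fun {a : ℕ} (ha : a < p - 1) =>
    hω.gaussSum_mulChar_inv_pow hp3 hπ hΓ ha (sub_one_mul_toZp a)
  have hev := hω.mulChar_apply K
  set Ω := hω.mulChar K
  set φ := (quadraticChar (ZMod p)).ringHomComp (Int.castRingHom K)
  have hφΩ : φ = (Ω ^ h)⁻¹ := by
    rw [hq, hh, eq_inv_iff_mul_eq_one, ← pow_add, ← two_mul, hh2, ← hord, pow_orderOf_eq_one]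
  have hφ : φ.IsQuadratic := (quadraticChar_isQuadratic (ZMod p)).comp _
  have hφ1 : φ ≠ 1 := by
    rw [hφΩ, Ne, inv_eq_one, ← orderOf_dvd_iff_pow_eq_one, hord]
    intro hdvd
    have := Nat.le_of_dvd (by omega) hdvd
    omega
  have h2 : (2 : ZMod p) ≠ 0 := by
    intro h
    have := (ZMod.natCast_eq_zero_iff 2 p).1 (by exact_mod_cast h)
    have := Nat.le_of_dvd (by norm_num) this
    omega
  have h3 : (3 : ZMod p) ≠ 0 := by
    intro h
    have := (ZMod.natCast_eq_zero_iff 3 p).1 (by exact_mod_cast h)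
    have := Nat.le_of_dvd (by norm_num) this
    omega
  have h4 : (4 / 27 : ZMod p) = 2 ^ 2 / 3 ^ 3 := by norm_num
  have h27 : (-(4 / 27) : ZMod p) ≠ 0 := by
    rw [h4]
    exact neg_ne_zero.2 (div_ne_zero (pow_ne_zero _ h2) (pow_ne_zero _ h3))
  have hmain := gaussSum_mul_sum_trinomial hφ hφ1 (Ω ^ j)⁻¹ (hω.dworkAddChar_isPrimitive hp3 hπ) h27
  have e1 : (Ω ^ j)⁻¹ ^ 3 = (Ω ^ d)⁻¹ := by
    rw [inv_pow, ← pow_mul, mul_comm j, hpow hdm]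
  have e2 : φ * (Ω ^ j)⁻¹⁻¹ ^ 2 = (Ω ^ b)⁻¹ := by
    rw [hφΩ, hpow hbm, pow_add, mul_comm 2, pow_mul, inv_inv]
    group
  have hpa : ∀ {x : ZMod p}, x ≠ 0 → ∀ n : ℕ, (Ω ^ n) x = Ω x ^ n := fun hx n => by
    obtain ⟨u, rfl⟩ := hx.isUnit
    exact MulChar.pow_apply_coe _ _ _
  have hne : ∀ {x : ZMod p}, x ≠ 0 → Ω x ≠ 0 := fun hx => (hx.isUnit.map Ω).ne_zero
  have e3 : Ω 2 ^ h * (Ω ^ j)⁻¹ (4 / 27) = Ω 2 ^ b * Ω 3 ^ d := by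
    have i1 : Ω 2 ^ h = Ω 2 ^ b * Ω 2 ^ (2 * j) := by
      rw [← hpa h2, hpow hbm, hpa h2, pow_add]
    have i2 : Ω 3 ^ d = Ω 3 ^ (3 * j) := by rw [← hpa h3, ← hpow hdm, hpa h3]
    rw [i1, i2, h4, MulChar.inv_apply', inv_div, hpa (div_ne_zero (pow_ne_zero _ h3)
      (pow_ne_zero _ h2)), div_eq_mul_inv, _root_.map_mul, ← MulChar.inv_apply',
      MulChar.inv_apply_eq_inv', _root_.map_pow, _root_.map_pow, mul_pow, inv_pow, pow_mul, pow_mul]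
    have := hne h2
    field_simp
  rw [e1, e2, inv_inv, neg_neg, ZMod.card] at hmain
  rw [hφΩ, hG (show h < p - 1 by omega), hG hj, hG hbN, hG hdN, ← hφΩ] at hmain
  have hπ0 : π ≠ 0 := by
    rintro rfl
    rw [zero_pow (by omega), eq_comm, map_eq_zero, neg_eq_zero] at hπ
    exact hp.out.ne_zero (by exact_mod_cast hπ)
  have e4 : π ^ b * π ^ d = π ^ h * π ^ j * (algebraMap ℚ_[p] K (-p)) ^ (-e₁ - e₂) := by
    rw [← hπ, ← zpow_natCast, ← zpow_natCast, ← zpow_natCast, ← zpow_natCast, ← zpow_natCast,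
      ← zpow_mul, ← zpow_add₀ hπ0, ← zpow_add₀ hπ0, ← zpow_add₀ hπ0]
    congr 1
    linear_combination hb1 + hd1
  have hT' := congrArg (algebraMap ℚ_[p] K) hT
  simp only [PadicInt.coe_mul, PadicInt.coe_pow, _root_.map_mul, _root_.map_pow, map_zpow₀,
    ← hev] at hT'
  have hΓ0 : ∀ x, algebraMap ℚ_[p] K (Γ x) ≠ 0 := fun x => by
    rw [Ne, map_eq_zero]
    exact fun h => hΓ.ne_zero x (Subtype.val_injective h)
  rw [_root_.map_mul, map_natCast]
  have hc : π ^ h * π ^ j * algebraMap ℚ_[p] K (Γ (toZp p (h / (p - 1 : ℕ)))) *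
      algebraMap ℚ_[p] K (Γ (toZp p (j / (p - 1 : ℕ)))) * Ω 2 ^ h ≠ 0 := by
    have := hΓ0 (toZp p (h / (p - 1 : ℕ)))
    have := hΓ0 (toZp p (j / (p - 1 : ℕ)))
    have := hne h2
    positivity
  refine mul_left_cancel₀ hc ?_
  generalize algebraMap ℚ_[p] K (Γ (toZp p (h / (p - 1 : ℕ)))) = v1 at *
  generalize algebraMap ℚ_[p] K (Γ (toZp p (j / (p - 1 : ℕ)))) = v2 at *
  generalize algebraMap ℚ_[p] K (Γ (toZp p (b / (p - 1 : ℕ)))) = v3 at *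
  generalize algebraMap ℚ_[p] K (Γ (toZp p (d / (p - 1 : ℕ)))) = v4 at *
  generalize (algebraMap ℚ_[p] K (-p)) ^ (-e₁ - e₂) = w at *
  generalize algebraMap ℚ_[p] K (padicGTerm p Γ j) = T at *
  generalize ∑ t, (Ω ^ j) t * ∑ x, φ (1 + x + -(4 / 27) * t * x ^ 3) = C at *
  linear_combination Ω 2 ^ h * hmain + (p : K) * π ^ b * π ^ d * v3 * v4 * e3 +
    (p : K) * v3 * v4 * Ω 2 ^ b * Ω 3 ^ d * e4 - (p : K) * π ^ h * π ^ j * hT'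

end IsTeichmuller

end fourier

section weierstrass

variable {p : ℕ} [hp : Fact p.Prime]

theorem sum_trinomial_eq_padicG {Γ : ℤ_[p] → ℤ_[p]} (hΓ : IsMoritaGamma Γ) {ω : ZMod p → ℤ_[p]}
    (hω : IsTeichmuller ω) (hp3 : 3 < p) {t : ZMod p} (ht : t ≠ 0) :
    ∑ x, (quadraticChar (ZMod p) (1 + x + -(4 / 27) * t * x ^ 3) : ℚ_[p]) =
      -(p * padicG p Γ ω 2 ![1/4, 3/4] ![1/3, 2/3] t) := by
  obtain ⟨π, hπ⟩ := IsAlgClosed.exists_pow_nat_eq (algebraMap ℚ_[p] ℂ_[p] (-p))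
    (show 0 < p - 1 by omega)
  have hG : padicG p Γ ω 2 ![1/4, 3/4] ![1/3, 2/3] t = -1 / ((p : ℚ_[p]) - 1) *
      ∑ j ∈ Finset.range (p - 1), (-1 : ℚ_[p]) ^ (j * 2) * ((((ω t : ℚ_[p]))⁻¹) ^ j) *
        padicGTerm p Γ j := rfl
  have h1 : (p : ℚ_[p]) - 1 ≠ 0 := sub_ne_zero.2 (by exact_mod_cast hp.out.one_lt.ne')
  have h2 := hω.sum_inv_mulChar_pow_mul (K := ℂ_[p]) ht fun s =>
    ∑ x, ((quadraticChar (ZMod p)).ringHomComp (Int.castRingHom ℂ_[p]))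
      (1 + x + -(4 / 27) * s * x ^ 3)
  rw [Finset.sum_congr rfl fun j hj => by
    rw [hω.sum_mulChar_pow_mul_trinomial hp3 hπ hΓ (Finset.mem_range.1 hj)]] at h2
  have h3 : ∑ j ∈ Finset.range (p - 1), ((ω t : ℚ_[p]))⁻¹ ^ j * (p * padicGTerm p Γ j) =
      (p - 1 : ℕ) * ∑ x, (quadraticChar (ZMod p) (1 + x + -(4 / 27) * t * x ^ 3) : ℚ_[p]) := by
    apply (algebraMap ℚ_[p] ℂ_[p]).injective
    rw [map_sum, map_mul, map_sum, map_natCast]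
    simpa only [map_mul, map_pow, map_inv₀, IsTeichmuller.mulChar_apply, map_intCast, map_natCast,
      MulChar.ringHomComp_apply, eq_intCast] using h2
  rw [Nat.cast_sub hp.out.one_le, Nat.cast_one] at h3
  refine mul_left_cancel₀ h1 ?_
  rw [← h3, hG]
  simp only [mul_comm _ 2, pow_mul, neg_one_sq, one_pow, one_mul]
  rw [Finset.sum_congr rfl fun j _ => mul_left_comm _ _ _, ← Finset.mul_sum]
  field_simp

theorem card_filter_sq_add_mul_eq (hp2 : p ≠ 2) (B C : ZMod p) :
    ((Finset.univ.filter fun y : ZMod p => y ^ 2 + B * y = C).card : ℤ) =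
      quadraticChar (ZMod p) (B ^ 2 + 4 * C) + 1 := by
  have h2 : (2 : ZMod p) ≠ 0 := by
    intro h
    have := (ZMod.natCast_eq_zero_iff 2 p).1 (by exact_mod_cast h)
    exact hp2 ((Nat.prime_dvd_prime_iff_eq hp.out Nat.prime_two).1 this)
  rw [← quadraticChar_card_sqrts (by rwa [ZMod.ringChar_zmod_n])]
  congr 1
  refine Finset.card_bij (fun y _ => 2 * y + B) (fun y hy => ?_) (fun y _ z _ h => ?_) fun z hz => ?_
  · simp only [Finset.mem_filter, Finset.mem_univ, true_and, Set.mem_toFinset, Set.mem_ofPred_eq] at hy ⊢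
    linear_combination 4 * hy
  · exact mul_left_cancel₀ h2 (add_right_cancel h)
  · simp only [Finset.mem_filter, Finset.mem_univ, true_and, Set.mem_toFinset,
      Set.mem_ofPred_eq] at hz ⊢
    refine ⟨(z - B) / 2, ?_, by field_simp; ring⟩
    field_simp
    linear_combination hz

/-- The number of affine points of a Weierstrass curve as a sum of Legendre symbols. -/
theorem card_weierstrass_eq (hp2 : p ≠ 2) (a1 a2 a3 a4 a6 : ZMod p) :
    ((Finset.univ.filter
          (fun xy : ZMod p × ZMod p =>
            xy.2 ^ 2 + a1 * xy.1 * xy.2 + a3 * xy.2 =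
              xy.1 ^ 3 + a2 * xy.1 ^ 2 + a4 * xy.1 + a6)).card : ℤ) =
      p + ∑ x, quadraticChar (ZMod p) (4 * x ^ 3 + (a1 ^ 2 + 4 * a2) * x ^ 2 +
        2 * (2 * a4 + a1 * a3) * x + (a3 ^ 2 + 4 * a6)) := by
  rw [Finset.card_filter, Fintype.sum_prod_type]
  push_cast
  have h : ∀ x : ZMod p, ∑ y : ZMod p, (if y ^ 2 + a1 * x * y + a3 * y =
      x ^ 3 + a2 * x ^ 2 + a4 * x + a6 then (1 : ℤ) else 0) =
      quadraticChar (ZMod p) (4 * x ^ 3 + (a1 ^ 2 + 4 * a2) * x ^ 2 +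
        2 * (2 * a4 + a1 * a3) * x + (a3 ^ 2 + 4 * a6)) + 1 := fun x => by
    have := card_filter_sq_add_mul_eq hp2 (a1 * x + a3) (x ^ 3 + a2 * x ^ 2 + a4 * x + a6)
    rw [Finset.card_filter] at this
    push_cast at this
    simp only [add_assoc, add_mul] at this ⊢
    rw [this]
    congr 2
    ring
  simp only [h, Finset.sum_add_distrib]
  simp [ZMod.card, add_comm]

theorem sum_quadraticChar_weierstrass (hp3 : 3 < p) {b2 b4 b6 c4 c6 : ZMod p}
    (h4 : c4 = b2 ^ 2 - 24 * b4) (h6 : c6 = -b2 ^ 3 + 36 * b2 * b4 - 216 * b6)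
    (hc4 : c4 ≠ 0) (hc6 : c6 ≠ 0) :
    ∑ x, quadraticChar (ZMod p) (4 * x ^ 3 + b2 * x ^ 2 + 2 * b4 * x + b6) =
      quadraticChar (ZMod p) (-6 * c6) *
        ∑ x, quadraticChar (ZMod p) (1 + x + -(4 / 27) * (c6 ^ 2 / c4 ^ 3) * x ^ 3) := by
  have h2 : (2 : ZMod p) ≠ 0 := by
    intro h
    have := Nat.le_of_dvd (by norm_num) ((ZMod.natCast_eq_zero_iff 2 p).1 (by exact_mod_cast h))
    omega
  have h3 : (3 : ZMod p) ≠ 0 := by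
    intro h
    have := Nat.le_of_dvd (by norm_num) ((ZMod.natCast_eq_zero_iff 3 p).1 (by exact_mod_cast h))
    omega
  have h12 : (12 : ZMod p) ≠ 0 := by
    rw [show (12 : ZMod p) = 2 ^ 2 * 3 by norm_num]
    exact mul_ne_zero (pow_ne_zero _ h2) h3
  have h18 : (18 : ZMod p) ≠ 0 := by
    rw [show (18 : ZMod p) = 2 * 3 ^ 2 by norm_num]
    exact mul_ne_zero h2 (pow_ne_zero _ h3)
  have h27 : (27 : ZMod p) ≠ 0 := by
    rw [show (27 : ZMod p) = 3 ^ 3 by norm_num]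
    exact pow_ne_zero _ h3
  have h36 : (36 : ZMod p) ≠ 0 := by
    rw [show (36 : ZMod p) = 12 * 3 by norm_num]
    exact mul_ne_zero h12 h3
  have h216 : (216 : ZMod p) ≠ 0 := by
    rw [show (216 : ZMod p) = 12 * 18 by norm_num]
    exact mul_ne_zero h12 h18
  have hu : c6 / (c4 * 18) ≠ 0 := div_ne_zero hc6 (mul_ne_zero hc4 h18)
  have hD : ∀ s : ZMod p, 4 * (s - b2 / 12) ^ 3 + b2 * (s - b2 / 12) ^ 2 +
      2 * b4 * (s - b2 / 12) + b6 = 4 * s ^ 3 - c4 / 12 * s - c6 / 216 := fun s => by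
    rw [h4, h6]
    field_simp
    ring
  rw [Finset.mul_sum, ← Equiv.sum_comp ((Equiv.mulLeft₀ _ hu).trans (Equiv.subRight (b2 / 12)))]
  refine Finset.sum_congr rfl fun x _ => ?_
  have hs : (1 / 36 : ZMod p) ≠ 0 := one_div_ne_zero h36
  have key : 4 * (c6 / (c4 * 18) * x - b2 / 12) ^ 3 + b2 * (c6 / (c4 * 18) * x - b2 / 12) ^ 2 +
      2 * b4 * (c6 / (c4 * 18) * x - b2 / 12) + b6 =
      (1 / 36) ^ 2 * ((-6 * c6) * (1 + x + -(4 / 27) * (c6 ^ 2 / c4 ^ 3) * x ^ 3)) := by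
    rw [hD]
    field_simp
    ring
  simp only [Equiv.trans_apply, Equiv.mulLeft₀_apply, Equiv.subRight_apply]
  rw [key, map_mul, map_mul, quadraticChar_sq_one' hs, one_mul]

end weierstrass

/-- **Corollary 1.2 (McCarthy)**: for a prime `p > 3` and an elliptic curve over `𝔽_p` in
Weierstrass form with `Δ ≠ 0` and `j(E) ≠ 0, 1728`,
`a_p(E) = φ(-6c₆) · p · ₂G₂[1/4, 3/4; 1/3, 2/3 | 1 - 1728/j(E)]_p`. -/
theorem trace_of_frobenius_weierstrass_eq_padicG (p : ℕ) [Fact p.Prime] (hp3 : 3 < p)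
    (Γ : ℤ_[p] → ℤ_[p]) (hΓcont : Continuous Γ) (hΓzero : Γ 0 = 1)
    (hΓnat : ∀ m : ℕ, 0 < m →
      Γ (m : ℤ_[p]) = (-1) ^ m * ∏ k ∈ (Finset.Ico 1 m).filter (fun k => ¬ p ∣ k), (k : ℤ_[p]))
    (ω : ZMod p → ℤ_[p]) (hω0 : ω 0 = 0)
    (hωmul : ∀ x y : ZMod p, ω (x * y) = ω x * ω y)
    (hωunit : ∀ x : ZMod p, x ≠ 0 → IsUnit (ω x))
    (hωcong : ∀ x : ZMod p, (p : ℤ_[p]) ∣ (ω x - (x.val : ℤ_[p])))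
    (a1 a2 a3 a4 a6 : ZMod p)
    (hΔ : wDelta p a1 a2 a3 a4 a6 ≠ 0)
    (hj0 : wj p a1 a2 a3 a4 a6 ≠ 0) (hj1728 : wj p a1 a2 a3 a4 a6 ≠ 1728) :
    ((p : ℚ_[p]) -
        ((Finset.univ.filter
          (fun xy : ZMod p × ZMod p =>
            xy.2 ^ 2 + a1 * xy.1 * xy.2 + a3 * xy.2 =
              xy.1 ^ 3 + a2 * xy.1 ^ 2 + a4 * xy.1 + a6)).card : ℚ_[p])) =
      (quadraticChar (ZMod p) (-6 * wc6 p a1 a2 a3 a4 a6) : ℚ_[p]) * (p : ℚ_[p]) *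
        padicG p Γ ω 2 ![1/4, 3/4] ![1/3, 2/3] (1 - 1728 / wj p a1 a2 a3 a4 a6) := by
  have hp2 : p ≠ 2 := by omega
  have hω : IsTeichmuller ω := ⟨hω0, hωmul, hωunit, hωcong⟩
  have hΓ : IsMoritaGamma Γ := ⟨hΓcont, hΓzero, hΓnat⟩
  have h1728 : (1728 : ZMod p) ≠ 0 := fun h => by
    have h1 : p ∣ 2 ^ 6 * 3 ^ 3 := (ZMod.natCast_eq_zero_iff _ p).1 (by norm_num; exact h)
    rcases (Nat.Prime.dvd_mul Fact.out).1 h1 with h | h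
    · exact absurd (Nat.le_of_dvd (by norm_num) (Nat.Prime.dvd_of_dvd_pow Fact.out h)) (by omega)
    · exact absurd (Nat.le_of_dvd (by norm_num) (Nat.Prime.dvd_of_dvd_pow Fact.out h)) (by omega)
  have hc4 : wc4 p a1 a2 a3 a4 ≠ 0 := fun h => hj0 (by rw [wj, h]; simp)
  have hD : wDelta p a1 a2 a3 a4 a6 * 1728 =
      wc4 p a1 a2 a3 a4 ^ 3 - wc6 p a1 a2 a3 a4 a6 ^ 2 := div_mul_cancel₀ _ h1728
  have hc6 : wc6 p a1 a2 a3 a4 a6 ≠ 0 := fun h => hj1728 (by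
    rw [wj, div_eq_iff hΔ, mul_comm, hD, h]; ring)
  have ht : 1 - 1728 / wj p a1 a2 a3 a4 a6 =
      wc6 p a1 a2 a3 a4 a6 ^ 2 / wc4 p a1 a2 a3 a4 ^ 3 := by
    rw [wj]
    field_simp
    linear_combination -hD
  have hcard := congrArg (Int.cast : ℤ → ℚ_[p]) (card_weierstrass_eq hp2 a1 a2 a3 a4 a6)
  rw [sum_quadraticChar_weierstrass hp3 (c4 := wc4 p a1 a2 a3 a4) (c6 := wc6 p a1 a2 a3 a4 a6)
    rfl rfl hc4 hc6] at hcard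
  have hG := sum_trinomial_eq_padicG hΓ hω hp3 (div_ne_zero (pow_ne_zero 2 hc6) (pow_ne_zero 3 hc4))
  push_cast at hcard
  rw [hcard, hG, ht]
  ring
end

section
/- Let p be an odd prime, t ∈ F_p, n a positive integer and a_1,…,a_n, b_1,…,b_n ∈ ℚ ∩ ℤ_p. For j ∈ ℤ define f(j) := #{i : 1 ≤ i ≤ n, ⟨a_i⟩ < j/(p−1)} − #{i : 1 ≤ i ≤ n, ⟨b_i⟩* ≤ j/(p−1)}, where ⟨b⟩* := 1 − ⟨−b⟩ (so ⟨b⟩* = ⟨b⟩ if b ∉ ℤ and ⟨b⟩* = 1 if b ∈ ℤ), and set δ := min{f(j) : 0 ≤ j ≤ p−2}. Then ₙGₙ[a_1,…,a_n; b_1,…,b_n | t]_p ∈ p^δ ℤ_p; that is, the p-adic valuation of ₙGₙ[a_1,…,a_n; b_1,…,b_n | t]_p is at least δ. -/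
/-- The quantity `f(j)` of Proposition: the number of `i` with `⟨a_i⟩ < j/(p-1)` minus
the number of `i` with `⟨b_i⟩* ≤ j/(p-1)`, where `⟨b⟩* = 1 - ⟨-b⟩`. -/
def fdelta (p n : ℕ) (A B : Fin n → ℚ) (j : ℕ) : ℤ :=
  ((Finset.univ.filter
      (fun i : Fin n => Int.fract (A i) < (j : ℚ) / ((p : ℚ) - 1))).card : ℤ) -
    ((Finset.univ.filter
      (fun i : Fin n => 1 - Int.fract (-(B i)) ≤ (j : ℚ) / ((p : ℚ) - 1))).card : ℤ)

/-- A continuous function on `ℤ_[p]` given on positive integers by Morita's product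
takes values in the units. -/
theorem norm_morita_eq_one (p : ℕ) [Fact p.Prime] (Γ : ℤ_[p] → ℤ_[p])
    (hΓcont : Continuous Γ) (hΓzero : Γ 0 = 1)
    (hΓnat : ∀ m : ℕ, 0 < m →
      Γ (m : ℤ_[p]) = (-1) ^ m * ∏ k ∈ (Finset.Ico 1 m).filter (fun k => ¬ p ∣ k), (k : ℤ_[p]))
    (x : ℤ_[p]) : ‖Γ x‖ = 1 := by
  refine PadicInt.denseRange_natCast.induction_on (p := fun x => ‖Γ x‖ = 1) x
    (isClosed_eq hΓcont.norm continuous_const) fun m => ?_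
  rcases Nat.eq_zero_or_pos m with rfl | hm
  · simp [hΓzero]
  · rw [hΓnat m hm, norm_mul, norm_pow, norm_neg, norm_one, one_pow, one_mul, norm_prod]
    refine Finset.prod_eq_one fun k hk => ?_
    have hpk : ¬ p ∣ k := (Finset.mem_filter.mp hk).2
    refine le_antisymm (PadicInt.norm_le_one _) (not_lt.mp fun h => hpk ?_)
    rw [← Int.cast_natCast, PadicInt.norm_int_lt_one_iff_dvd] at h
    exact_mod_cast h

theorem neg_floor_fract_sub (a x : ℚ) (h0 : 0 ≤ x) (h1 : x < 1) :
    -⌊Int.fract a - x⌋ = if Int.fract a < x then 1 else 0 := by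
  have ha0 := Int.fract_nonneg a
  have ha1 := Int.fract_lt_one a
  split_ifs with h
  · have : ⌊Int.fract a - x⌋ = -1 := by
      rw [Int.floor_eq_iff]; push_cast; constructor <;> linarith
    rw [this, neg_neg]
  · have : ⌊Int.fract a - x⌋ = 0 := by
      rw [Int.floor_eq_iff]; push_cast; constructor <;> linarith
    rw [this, neg_zero]

theorem floor_fract_add (b x : ℚ) (h0 : 0 ≤ x) (h1 : x < 1) :
    ⌊Int.fract b + x⌋ = if 1 - Int.fract b ≤ x then 1 else 0 := by
  have hb0 := Int.fract_nonneg b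
  have hb1 := Int.fract_lt_one b
  split_ifs with h <;> rw [Int.floor_eq_iff] <;> push_cast <;> constructor <;> linarith

/-- The total power of `-p` in the `j`-th summand of `padicG` is `fdelta`. -/
theorem sum_exponent_eq_fdelta (p n : ℕ) (A B : Fin n → ℚ) (j : ℕ) (hj : j < p - 1) :
    ∑ i : Fin n, (-⌊Int.fract (A i) - (j : ℚ) / ((p : ℚ) - 1)⌋ -
      ⌊Int.fract (-(B i)) + (j : ℚ) / ((p : ℚ) - 1)⌋) = fdelta p n A B j := by
  have hjp : (j : ℚ) < (p : ℚ) - 1 := by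
    have h : j + 1 < p := by omega
    have h' : (j : ℚ) + 1 < p := by exact_mod_cast h
    linarith
  have hj0 : (0 : ℚ) ≤ j := j.cast_nonneg
  have hpos : (0 : ℚ) < (p : ℚ) - 1 := hj0.trans_lt hjp
  have h0 : 0 ≤ (j : ℚ) / ((p : ℚ) - 1) := div_nonneg hj0 hpos.le
  have h1 : (j : ℚ) / ((p : ℚ) - 1) < 1 := (div_lt_one hpos).mpr hjp
  simp_rw [neg_floor_fract_sub _ _ h0 h1, floor_fract_add _ _ h0 h1]
  rw [Finset.sum_sub_distrib, Finset.sum_boole, Finset.sum_boole, fdelta]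

/-- **Proposition (McCarthy)**: `ₙGₙ[a₁,…,aₙ; b₁,…,bₙ | t]_p ∈ p^δ ℤ_p`, where
`δ = min { f(j) : 0 ≤ j ≤ p-2 }`; i.e. `‖ₙGₙ[⋯]‖_p ≤ p^{-δ}`. -/
theorem padicG_mem_pow_delta (p : ℕ) [Fact p.Prime] (hodd : Odd p)
    (Γ : ℤ_[p] → ℤ_[p]) (hΓcont : Continuous Γ) (hΓzero : Γ 0 = 1)
    (hΓnat : ∀ m : ℕ, 0 < m →
      Γ (m : ℤ_[p]) = (-1) ^ m * ∏ k ∈ (Finset.Ico 1 m).filter (fun k => ¬ p ∣ k), (k : ℤ_[p]))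
    (ω : ZMod p → ℤ_[p]) (hω0 : ω 0 = 0)
    (hωmul : ∀ x y : ZMod p, ω (x * y) = ω x * ω y)
    (hωunit : ∀ x : ZMod p, x ≠ 0 → IsUnit (ω x))
    (hωcong : ∀ x : ZMod p, (p : ℤ_[p]) ∣ (ω x - (x.val : ℤ_[p])))
    (t : ZMod p) (n : ℕ) (hn : 0 < n) (A B : Fin n → ℚ)
    (hA : ∀ i, ‖((A i : ℚ) : ℚ_[p])‖ ≤ 1) (hB : ∀ i, ‖((B i : ℚ) : ℚ_[p])‖ ≤ 1) :
    ‖padicG p Γ ω n A B t‖ ≤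
      (p : ℝ) ^
        (-(Finset.range (p - 1)).inf'
            (Finset.nonempty_range_iff.mpr
              (Nat.sub_ne_zero_of_lt (Fact.out : p.Prime).one_lt))
            (fdelta p n A B)) := by
  have hp : p.Prime := Fact.out
  have hp1 : (1 : ℝ) ≤ p := by exact_mod_cast hp.one_lt.le
  have hp0 : (p : ℝ) ≠ 0 := by exact_mod_cast hp.ne_zero
  have hΓ : ∀ x, ‖(Γ x : ℚ_[p])‖ = 1 := fun x => by
    rw [← PadicInt.norm_def]
    exact norm_morita_eq_one p Γ hΓcont hΓzero hΓnat x
  have hω : ‖((ω t : ℚ_[p]))⁻¹‖ ≤ 1 := by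
    by_cases ht : t = 0
    · simp [ht, hω0]
    · rw [norm_inv, ← PadicInt.norm_def, PadicInt.isUnit_iff.mp (hωunit t ht), inv_one]
  have hpred : ‖(p : ℚ_[p]) - 1‖ = 1 := by
    have h : ‖(p : ℚ_[p])‖ < 1 := Padic.norm_p_lt_one
    rw [sub_eq_add_neg, Padic.add_eq_max_of_ne (by rw [norm_neg, norm_one]; exact h.ne),
      norm_neg, norm_one, max_eq_right h.le]
  rw [padicG, norm_mul, norm_div, norm_neg, norm_one, hpred, div_one, one_mul]
  refine IsUltrametricDist.norm_sum_le_of_forall_le_of_nonneg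
    (zpow_nonneg p.cast_nonneg _) fun j hj => ?_
  have hprod : ∀ k : Fin n → ℤ, ∏ i, ‖(p : ℚ_[p])‖ ^ k i = (p : ℝ) ^ (-∑ i, k i) := fun k => by
    induction (Finset.univ : Finset (Fin n)) using Finset.induction_on with
    | empty => simp
    | insert i s hi ih =>
      rw [Finset.prod_insert hi, Finset.sum_insert hi, ih, neg_add, zpow_add₀ hp0,
        Padic.norm_p, inv_zpow']
  simp only [norm_mul, norm_prod, norm_div, norm_pow, norm_zpow, norm_neg, norm_one, one_pow,
    one_mul, hΓ, div_one, hprod]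
  rw [sum_exponent_eq_fdelta p n A B j (Finset.mem_range.mp hj)]
  calc _ ≤ 1 * (p : ℝ) ^ (-fdelta p n A B j) :=
        mul_le_mul_of_nonneg_right (pow_le_one₀ (norm_nonneg _) hω)
          (zpow_nonneg p.cast_nonneg _)
    _ ≤ _ := by
        rw [one_mul]
        exact zpow_le_zpow_right₀ hp1 (neg_le_neg (Finset.inf'_le _ hj))
end

section
/- Let p be an odd prime, let θ : F_p → ℂ^* be a nontrivial additive character, let T be a multiplicative character of F_p with values in ℂ of order p−1 (a generator of the character group of F_p^*), and let a, b ∈ F_p^*. Then, as an identity in ℂ, Σ_{y, x_1, x_2 ∈ F_p^*} θ(y(x_1³ + ax_1 + b − x_2²)) = − Σ_{y, x_1 ∈ F_p^*} θ(y(x_1³ + ax_1 + b)) + (φ(−b)/(p−1)) · Σ_{j=0}^{p−2} g(T^{−j}) · g(T^{(p−1)/2 − 2j}) · g(T^{3j}) · g(T^{(p−1)/2}) · T^{−3j}(a) · T^{2j}(b). -/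
open Finset in
/-- A sum over the nonzero elements of a field is a sum over its units. -/
theorem sum_univ_sdiff_zero_eq_sum_units {F M : Type*} [Field F] [Fintype F] [DecidableEq F]
    [AddCommMonoid M] (f : F → M) :
    ∑ x ∈ univ \ {(0 : F)}, f x = ∑ u : Fˣ, f u := by
  symm
  refine Finset.sum_bij (fun u _ => (u : F)) (fun u _ => by simp) (fun u _ v _ h => Units.ext h)
    (fun x hx => ?_) (fun _ _ => rfl)
  exact ⟨Units.mk0 x (by simpa using hx), mem_univ _, rfl⟩

theorem gaussSum_eq_sum_units {F R : Type*} [Field F] [Fintype F] [DecidableEq F] [CommRing R]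
    (χ : MulChar F R) (θ : AddChar F R) :
    gaussSum χ θ = ∑ u : Fˣ, χ u * θ u := by
  rw [← sum_univ_sdiff_zero_eq_sum_units (fun x => χ x * θ x), gaussSum]
  symm
  refine Finset.sum_subset (Finset.subset_univ _) (fun x _ hx => ?_)
  obtain rfl : x = 0 := by simpa using hx
  rw [MulChar.map_zero, zero_mul]

theorem MulChar.zpow_apply_unit {F : Type*} [Field F] (χ : MulChar F ℂ) (n : ℤ) (u : Fˣ) :
    (χ ^ n) (u : F) = (χ u) ^ n := by
  cases n with
  | ofNat k => simp [MulChar.pow_apply_coe]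
  | negSucc k =>
    rw [zpow_negSucc, zpow_negSucc, ← MulChar.pow_apply_coe]
    have h : (χ ^ (k + 1))⁻¹ (u : F) * (χ ^ (k + 1)) (u : F) = 1 := by
      rw [← MulChar.mul_apply, inv_mul_cancel, MulChar.one_apply_coe]
    exact eq_inv_of_mul_eq_one_left h

/-- A generator of the character group of `F` separates `1` from the other units. -/
theorem MulChar.eq_one_of_apply_eq_one {F : Type*} [Field F] [Fintype F]
    (T : MulChar F ℂ) (hT : orderOf T = Fintype.card F - 1) (u : Fˣ) (hu : T u = 1) : u = 1 := by
  classical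
  obtain ⟨ζ, hζ⟩ := IsCyclic.exists_monoid_generator (α := Fˣ)
  obtain ⟨k, rfl⟩ := Submonoid.mem_powers_iff _ _ |>.1 (hζ u)
  have hk : T ^ k = 1 := by
    ext v
    obtain ⟨l, rfl⟩ := Submonoid.mem_powers_iff _ _ |>.1 (hζ v)
    rw [MulChar.pow_apply_coe, MulChar.one_apply_coe]
    rw [Units.val_pow_eq_pow_val, map_pow] at hu ⊢
    rw [← pow_mul, mul_comm, pow_mul, hu, one_pow]
  have hd := orderOf_dvd_of_pow_eq_one hk
  rw [hT, ← Fintype.card_units] at hd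
  exact orderOf_dvd_iff_pow_eq_one.1 ((orderOf_dvd_card).trans hd)

theorem MulChar.sum_range_pow_apply {F : Type*} [Field F] [Fintype F] [DecidableEq F]
    (T : MulChar F ℂ) (hT : orderOf T = Fintype.card F - 1) (u : Fˣ) :
    ∑ j ∈ Finset.range (Fintype.card F - 1), T u ^ j =
      if u = 1 then ((Fintype.card F - 1 : ℕ) : ℂ) else 0 := by
  split_ifs with h
  · simp [h]
  · have h1 : T u ≠ 1 := fun h' => h (T.eq_one_of_apply_eq_one hT u h')
    rw [geom_sum_eq h1, ← hT, ← MulChar.pow_apply_coe, pow_orderOf_eq_one, MulChar.one_apply_coe,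
      sub_self, zero_div]

/-- The middle power of a generator of the character group is the quadratic character. -/
theorem MulChar.pow_half_apply {F : Type*} [Field F] [Fintype F] [DecidableEq F]
    (hF : ringChar F ≠ 2) (T : MulChar F ℂ) (hT : orderOf T = Fintype.card F - 1) (x : F) :
    (T ^ (Fintype.card F / 2)) x = (quadraticChar F x : ℂ) := by
  rcases eq_or_ne x 0 with rfl | hx
  · simp
  lift x to Fˣ using hx.isUnit
  have hpow := quadraticChar_eq_pow_of_char_ne_two' hF (x : F)
  rw [MulChar.pow_apply_coe, ← map_pow, ← hpow]
  rcases quadraticChar_dichotomy x.ne_zero with h | h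
  · simp [h]
  · have h1 : T (-1) ≠ 1 := fun h' => by
      have h2 := T.eq_one_of_apply_eq_one hT (-1) (by simpa using h')
      exact Ring.neg_one_ne_one_of_char_ne_two hF (by simpa using congrArg Units.val h2)
    have h3 : T (-1) * T (-1) = 1 := by rw [← map_mul]; simp
    rcases mul_self_eq_one_iff.1 h3 with h4 | h4
    · exact absurd h4 h1
    · simp [h, h4]

/-- The sum of an additive character over nonzero squares, scaled by a unit. -/
theorem sum_units_addChar_mul_sq {F : Type*} [Field F] [Fintype F] [DecidableEq F]
    (hF : ringChar F ≠ 2) (θ : AddChar F ℂ) (hθ : θ ≠ 1) (χ : MulChar F ℂ)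
    (hχ : ∀ x, χ x = (quadraticChar F x : ℂ)) (c : Fˣ) :
    ∑ x : Fˣ, θ (c * (x : F) ^ 2) = χ c * gaussSum χ θ - 1 := by
  have hprim : ∑ x : F, θ (c * x) = 0 := by
    rw [Fintype.sum_equiv (Units.mulLeft c) (fun x => θ (c * x)) (fun x => θ x) (fun _ => rfl)]
    exact AddChar.sum_eq_zero_of_ne_one hθ
  have hsq : ∑ x : F, θ (c * x ^ 2) = ∑ x : F, (1 + χ x) * θ (c * x) := by
    rw [← Finset.sum_fiberwise_of_maps_to (s := Finset.univ) (t := Finset.univ)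
      (g := fun x : F => x ^ 2) (fun _ _ => Finset.mem_univ _)]
    refine Finset.sum_congr rfl fun y _ => ?_
    rw [Finset.sum_congr rfl (g := fun _ => θ (c * y)) (fun x hx => by
      rw [(Finset.mem_filter.1 hx).2])]
    have := quadraticChar_card_sqrts hF y
    rw [Finset.sum_const, nsmul_eq_mul, hχ]
    congr 1
    have h2 : ((Finset.univ.filter fun x : F => x ^ 2 = y).card : ℤ) = quadraticChar F y + 1 := by
      rw [← this]; congr 2; ext; simp
    rw [add_comm]
    exact_mod_cast h2
  have hgs : ∑ x : F, χ x * θ (c * x) = χ c * gaussSum χ θ := by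
    have hcc : χ c * χ c = 1 := by
      rw [hχ, ← sq]
      exact_mod_cast quadraticChar_sq_one c.ne_zero
    have h := gaussSum_mulShift χ θ c
    rw [← h, ← mul_assoc, hcc, one_mul]
    simp [gaussSum, AddChar.mulShift_apply]
  have hsplit : ∑ x : F, θ (c * x ^ 2) = ∑ x : Fˣ, θ (c * (x : F) ^ 2) + 1 := by
    rw [← sum_univ_sdiff_zero_eq_sum_units (fun x : F => θ (c * x ^ 2)),
      ← Finset.sum_sdiff (Finset.subset_univ {(0 : F)})]
    simp
  rw [eq_sub_iff_add_eq, ← hsplit, hsq]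
  simp only [add_mul, one_mul, Finset.sum_add_distrib, hprim, zero_add, hgs]

/-- Orthogonality collapses the character sum of products of three Gauss sums to an exponential
sum in two variables. -/
theorem sum_range_gaussSum_mul {F : Type*} [Field F] [Fintype F] [DecidableEq F]
    (θ : AddChar F ℂ) (T : MulChar F ℂ) (hT : orderOf T = Fintype.card F - 1) (m : ℕ)
    (a b : Fˣ) :
    ∑ j ∈ Finset.range (Fintype.card F - 1),
        gaussSum (T ^ (-(j : ℤ))) θ * gaussSum (T ^ ((m : ℤ) - 2 * (j : ℤ))) θ *
          gaussSum (T ^ (3 * (j : ℤ))) θ * (T ^ (-3 * (j : ℤ))) a * (T ^ (2 * (j : ℤ))) b =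
      ((Fintype.card F - 1 : ℕ) : ℂ) * ∑ y : Fˣ, ∑ x : Fˣ,
        (T ^ m) (b * y : F) * θ (y * ((x : F) ^ 3 + a * x + b)) := by
  have hterm (j : ℕ) :
      gaussSum (T ^ (-(j : ℤ))) θ * gaussSum (T ^ ((m : ℤ) - 2 * (j : ℤ))) θ *
          gaussSum (T ^ (3 * (j : ℤ))) θ * (T ^ (-3 * (j : ℤ))) a * (T ^ (2 * (j : ℤ))) b =
        ∑ v : Fˣ, ∑ w : Fˣ, ∑ u : Fˣ,
          T ((u⁻¹ * (v⁻¹ ^ 2 * w ^ 3 * a⁻¹ ^ 3 * b ^ 2) : Fˣ) : F) ^ j *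
            ((T ^ m) v * θ (u + v + w)) := by
    have hT0 (u : Fˣ) : T u ≠ 0 := (u.isUnit.map T).ne_zero
    have hpoint (u v w : Fˣ) :
        T ((u⁻¹ * (v⁻¹ ^ 2 * w ^ 3 * a⁻¹ ^ 3 * b ^ 2) : Fˣ) : F) ^ j *
            ((T ^ m) v * θ (u + v + w)) =
          ((T ^ (-(j : ℤ))) u * θ u) * ((T ^ ((m : ℤ) - 2 * (j : ℤ))) v * θ v) *
            ((T ^ (3 * (j : ℤ))) w * θ w) * (T ^ (-3 * (j : ℤ))) a * (T ^ (2 * (j : ℤ))) b := by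
      have hinv (u : Fˣ) : T ((u⁻¹ : Fˣ) : F) = (T u)⁻¹ := by
        refine eq_inv_of_mul_eq_one_left ?_
        rw [← map_mul, Units.inv_mul, map_one]
      have hu := hT0 u
      have hv := hT0 v
      have ha := hT0 a
      simp only [MulChar.zpow_apply_unit]
      simp only [MulChar.pow_apply_coe, Units.val_mul,
        Units.val_pow_eq_pow_val, map_mul, map_pow, hinv, AddChar.map_add_eq_mul, zpow_sub₀ hv,
        neg_mul, zpow_neg, zpow_mul, zpow_natCast, zpow_ofNat]
      simp only [mul_pow, inv_pow]
      field_simp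
    simp only [gaussSum_eq_sum_units, hpoint, ← Finset.sum_mul, ← Finset.mul_sum]
  rw [Finset.sum_congr rfl (fun j _ => hterm j), Finset.sum_comm]
  rw [← Equiv.sum_comp (Equiv.mulLeft b), Finset.mul_sum]
  refine Finset.sum_congr rfl fun y _ => ?_
  rw [Finset.sum_comm, ← Equiv.sum_comp (Equiv.mulLeft (y * a)), Finset.mul_sum]
  refine Finset.sum_congr rfl fun x _ => ?_
  rw [Finset.sum_comm]
  simp only [← Finset.sum_mul, T.sum_range_pow_apply hT, inv_mul_eq_one, ite_mul, zero_mul,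
    Finset.sum_ite_eq', Finset.mem_univ, if_true]
  simp only [Equiv.coe_mulLeft, Units.val_mul]
  congr 3
  push_cast
  have := y.ne_zero
  have := a.ne_zero
  have := b.ne_zero
  field_simp
  ring


/-- **Evaluation of `S₄`**: for an odd prime `p`, a nontrivial additive character `θ`,
a generator `T` of the character group of `𝔽_p^*` (a multiplicative character of order `p-1`),
and `a, b ∈ 𝔽_p^*`:
`Σ_{y,x₁,x₂ ∈ 𝔽_p^*} θ(y(x₁³+ax₁+b-x₂²))
  = -Σ_{y,x₁ ∈ 𝔽_p^*} θ(y(x₁³+ax₁+b))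
    + (φ(-b)/(p-1))·Σ_{j=0}^{p-2} g(T^{-j})g(T^{(p-1)/2-2j})g(T^{3j})g(T^{(p-1)/2})T^{-3j}(a)T^{2j}(b)`. -/
theorem char_sum_S4 (p : ℕ) [Fact p.Prime] (hodd : Odd p)
    (θ : AddChar (ZMod p) ℂ) (hθ : θ ≠ 1)
    (T : MulChar (ZMod p) ℂ) (hT : orderOf T = p - 1)
    (a b : ZMod p) (ha : a ≠ 0) (hb : b ≠ 0) :
    ∑ y ∈ Finset.univ \ {(0 : ZMod p)}, ∑ x1 ∈ Finset.univ \ {(0 : ZMod p)},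
        ∑ x2 ∈ Finset.univ \ {(0 : ZMod p)},
          θ (y * (x1 ^ 3 + a * x1 + b - x2 ^ 2)) =
      -(∑ y ∈ Finset.univ \ {(0 : ZMod p)}, ∑ x1 ∈ Finset.univ \ {(0 : ZMod p)},
          θ (y * (x1 ^ 3 + a * x1 + b))) +
        ((quadraticChar (ZMod p) (-b) : ℂ) / ((p : ℂ) - 1)) *
          ∑ j ∈ Finset.range (p - 1),
            gaussSum (T ^ (-(j : ℤ))) θ *
              gaussSum (T ^ ((((p - 1) / 2 : ℕ) : ℤ) - 2 * (j : ℤ))) θ *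
              gaussSum (T ^ (3 * (j : ℤ))) θ *
              gaussSum (T ^ ((p - 1) / 2 : ℕ)) θ *
              (T ^ (-3 * (j : ℤ))) a * (T ^ (2 * (j : ℤ))) b := by
  have hF : ringChar (ZMod p) ≠ 2 := by
    rw [ZMod.ringChar_zmod_n]
    rintro rfl
    exact absurd hodd (by decide)
  have hcard : Fintype.card (ZMod p) = p := ZMod.card p
  have hhalf : Fintype.card (ZMod p) / 2 = (p - 1) / 2 := by
    obtain ⟨k, rfl⟩ := hodd
    rw [hcard]
    omega
  have hT' : orderOf T = Fintype.card (ZMod p) - 1 := by rw [hT, hcard]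
  have hχ (x : ZMod p) : (T ^ ((p - 1) / 2)) x = (quadraticChar (ZMod p) x : ℂ) := by
    rw [← hhalf]
    exact T.pow_half_apply hF hT' x
  lift a to (ZMod p)ˣ using ha.isUnit
  lift b to (ZMod p)ˣ using hb.isUnit
  have hmain := sum_range_gaussSum_mul θ T hT' ((p - 1) / 2) a b
  rw [hcard] at hmain
  set χ := T ^ ((p - 1) / 2) with hχdef
  have hbb : χ b * χ b = 1 := by
    rw [hχ, ← sq]
    exact_mod_cast quadraticChar_sq_one b.ne_zero
  have hp : ((p - 1 : ℕ) : ℂ) = (p : ℂ) - 1 := by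
    rw [Nat.cast_sub (Fact.out : p.Prime).one_le, Nat.cast_one]
  have hp0 : (p : ℂ) - 1 ≠ 0 := by
    rw [sub_ne_zero]
    exact_mod_cast (Fact.out : p.Prime).ne_one
  have hx2 (y x : (ZMod p)ˣ) :
      ∑ z : (ZMod p)ˣ, θ (y * ((x : ZMod p) ^ 3 + a * x + b - (z : ZMod p) ^ 2)) =
        -θ (y * ((x : ZMod p) ^ 3 + a * x + b)) + χ (-b) * gaussSum χ θ *
          (χ (b * y) * θ (y * ((x : ZMod p) ^ 3 + a * x + b))) := by
    have hsq := sum_units_addChar_mul_sq hF θ hθ χ hχ (-y)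
    have hneg : χ ((-y : (ZMod p)ˣ) : ZMod p) = χ (-b) * χ (b * y) := by
      rw [← map_mul, show -(b : ZMod p) * (b * y) = b * b * ((-y : (ZMod p)ˣ) : ZMod p) by
        push_cast; ring, map_mul, map_mul, hbb, one_mul]
    have hadd (z : (ZMod p)ˣ) :
        θ (y * ((x : ZMod p) ^ 3 + a * x + b - (z : ZMod p) ^ 2)) =
          θ (y * ((x : ZMod p) ^ 3 + a * x + b)) *
            θ (((-y : (ZMod p)ˣ) : ZMod p) * (z : ZMod p) ^ 2) := by
      rw [← AddChar.map_add_eq_mul]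
      congr 1
      push_cast
      ring
    simp only [hadd, ← Finset.mul_sum, hsq, hneg]
    ring
  have hgauss (j : ℕ) :
      gaussSum (T ^ (-(j : ℤ))) θ * gaussSum (T ^ ((((p - 1) / 2 : ℕ) : ℤ) - 2 * (j : ℤ))) θ *
          gaussSum (T ^ (3 * (j : ℤ))) θ * gaussSum χ θ *
          (T ^ (-3 * (j : ℤ))) a * (T ^ (2 * (j : ℤ))) b =
        gaussSum χ θ * (gaussSum (T ^ (-(j : ℤ))) θ *
          gaussSum (T ^ ((((p - 1) / 2 : ℕ) : ℤ) - 2 * (j : ℤ))) θ *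
          gaussSum (T ^ (3 * (j : ℤ))) θ * (T ^ (-3 * (j : ℤ))) a * (T ^ (2 * (j : ℤ))) b) := by
    ring
  simp only [sum_univ_sdiff_zero_eq_sum_units, hx2, hgauss]
  rw [← Finset.mul_sum, hmain, ← hχ, hp]
  simp only [Finset.sum_add_distrib, Finset.sum_neg_distrib, ← Finset.mul_sum]
  field_simp
end
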